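/- arXiv:0904.1540 — 3 statements merged into one kernel-verified Lean document; each statement's English description precedes it below -/
import Mathlib

section
/- Let (R, m) be a Noetherian complete local domain. (i) If the Krull dimension of R^+ equals 1, then R^+ is a valuation domain whose value group is ℚ, i.e., there is a valuation on the field of fractions of R^+ with valuation ring R^+ and value group isomorphic to (ℚ, +). (ii) Conversely, if R^+ is a valuation domain, then the Krull dimension of R^+ is at most 1. -/
set_option synthInstance.maxHeartbeats 400000
set_option maxHeartbeats 1000000

universe u

/-- The absolute integral closure `R⁺` of a domain `R`: the integral closure of `R`
inside an algebraic closure of its field of fractions. -/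
abbrev RPlus (R : Type u) [CommRing R] [IsDomain R] : Type u :=
  ↥(integralClosure R (AlgebraicClosure (FractionRing R)))

section RPlusAux
open IsLocalRing


theorem precomplete_fin {R : Type*} [CommRing R] (I : Ideal R) [IsAdicComplete I R] (n : ℕ) :
    IsPrecomplete I (Fin n → R) := by
  rw [← AdicCompletion.of_surjective_iff]
  intro y
  let z := AdicCompletion.piEquivOfFintype I (fun _ : Fin n => R) y
  choose w hw using fun j => AdicCompletion.of_surjective I R (z j)
  refine ⟨w, ?_⟩
  apply (AdicCompletion.piEquivOfFintype I (fun _ : Fin n => R)).injective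
  funext j
  change _ = z j
  rw [← hw j]
  exact AdicCompletion.map_of _ _ _

theorem precomplete_finite {R : Type*} [CommRing R] (I : Ideal R) [IsAdicComplete I R]
    (M : Type*) [AddCommGroup M] [Module R M] [Module.Finite R M] :
    IsPrecomplete I M := by
  obtain ⟨n, f, hf⟩ := Module.Finite.exists_fin' R M
  have := precomplete_fin I n
  rw [← AdicCompletion.of_surjective_iff]
  intro y
  obtain ⟨z, rfl⟩ := AdicCompletion.map_surjective I hf y
  obtain ⟨w, rfl⟩ := AdicCompletion.of_surjective I _ z
  exact ⟨f w, (AdicCompletion.map_of _ _ _).symm⟩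

theorem isLocalRing_of_finite (R : Type*) [CommRing R] [IsNoetherianRing R]
    [IsLocalRing R] [IsAdicComplete (maximalIdeal R) R]
    (S : Type*) [CommRing S] [IsDomain S] [Algebra R S] [Module.Finite R S] :
    IsLocalRing S := by
  let J := (maximalIdeal R).map (algebraMap R S)
  have h1 : IsPrecomplete J S := (IsPrecomplete.map_algebraMap_iff (R := R)).2
    (precomplete_finite _ _)
  have h2 : IsHausdorff J S := (IsHausdorff.map_algebraMap_iff (R := R)).2 inferInstance
  have h3 : IsAdicComplete J S := ⟨⟩
  have hloc := isLocalHom_of_le_jacobson_bot J (IsAdicComplete.le_jacobson_bot J)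
  have hart : IsArtinianRing (S ⧸ J) := by
    let _ : Algebra (R ⧸ maximalIdeal R) (S ⧸ J) := inferInstance
    have : Module.Finite (R ⧸ maximalIdeal R) (S ⧸ J) := 
      Module.Finite.of_restrictScalars_finite R _ _
    let _ : Field (R ⧸ maximalIdeal R) := Ideal.Quotient.field _
    exact IsArtinianRing.of_finite (R ⧸ maximalIdeal R) (S ⧸ J)
  refine IsLocalRing.of_isUnit_or_isUnit_one_sub_self fun e => ?_
  obtain ⟨n, y, hy⟩ := IsArtinian.exists_pow_succ_smul_dvd (R := S ⧸ J) (M := S ⧸ J)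
    (Ideal.Quotient.mk J e) 1
  obtain ⟨y, rfl⟩ := Ideal.Quotient.mk_surjective y
  set q := Ideal.Quotient.mk J
  simp only [smul_eq_mul, mul_one] at hy
  -- idempotent
  have key : ∀ k, q e ^ n = q e ^ (n + k) * q y ^ k := by
    intro k
    induction k with
    | zero => simp
    | succ k ih =>
      calc q e ^ n = q e ^ (n+k) * q y ^ k := ih
        _ = (q e ^ k * q y ^ k) * q e ^ n := by ring
        _ = (q e ^ k * q y ^ k) * (q e ^ n.succ * q y) := by rw [hy]
        _ = _ := by rw [Nat.succ_eq_add_one]; ring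
  let g := e ^ n * y ^ n
  have hg : q g * q g = q g := by
    simp only [g, map_mul, map_pow]
    calc _ = (q e ^ (n+n) * q y ^ n) * q y ^ n := by ring
      _ = _ := by rw [← key]
  have hmon : (Polynomial.X ^ 2 - Polynomial.X : Polynomial S).Monic := by
    monicity!
  obtain ⟨a, ha, hag⟩ := HenselianRing.is_henselian (I := J)
    (Polynomial.X ^ 2 - Polynomial.X : Polynomial S) hmon g
    (by
      rw [← Ideal.Quotient.eq_zero_iff_mem]
      simp [pow_two]
      exact sub_eq_zero.2 hg)
    (by
      refine IsUnit.of_mul_eq_one (q (2 * g - 1)) ?_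
      have h2 : q 2 = 2 := map_ofNat q 2
      simp [h2]
      linear_combination 4 * hg)
  have ha' : a * (a - 1) = 0 := by
    simp [Polynomial.IsRoot] at ha
    linear_combination ha
  have hqa : q a = q g := by rw [← sub_eq_zero, ← map_sub]; exact Ideal.Quotient.eq_zero_iff_mem.2 hag
  rcases mul_eq_zero.1 ha' with h | h
  · right
    have h0 : q e ^ n = 0 := by
      rw [key n, pow_add, mul_assoc, ← map_pow, ← map_pow, ← map_mul, ← map_mul]
      change q (e ^ n * g) = 0
      rw [map_mul, ← hqa, h]; simp
    apply IsUnit.of_map q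
    rw [map_sub, map_one]
    exact IsNilpotent.isUnit_one_sub ⟨n, h0⟩
  · left
    have h1 : q g = 1 := by rw [← hqa, sub_eq_zero.1 h, map_one]
    rcases Nat.eq_zero_or_pos n with rfl | hn
    · apply IsUnit.of_map q
      exact IsUnit.of_mul_eq_one (q y) (by simpa using hy)
    · have : IsUnit g := IsUnit.of_map q g (by rw [h1]; exact isUnit_one)
      exact (isUnit_pow_iff hn.ne').1 (isUnit_of_mul_isUnit_left this)

theorem isLocalRing_of_integral (R : Type*) [CommRing R] [IsNoetherianRing R]
    [IsLocalRing R] [IsAdicComplete (maximalIdeal R) R]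
    (A : Type*) [CommRing A] [IsDomain A] [Algebra R A] [Algebra.IsIntegral R A] :
    IsLocalRing A := by
  refine IsLocalRing.of_isUnit_or_isUnit_one_sub_self fun e => ?_
  have : Module.Finite R (Algebra.adjoin R {e}) :=
    Algebra.finite_adjoin_simple_of_isIntegral (Algebra.IsIntegral.isIntegral e)
  have := isLocalRing_of_finite R (Algebra.adjoin R {e})
  let e' : Algebra.adjoin R {e} := ⟨e, Algebra.self_mem_adjoin_singleton R e⟩
  rcases IsLocalRing.isUnit_or_isUnit_one_sub_self e' with h | h
  · left; exact h.map (algebraMap _ A)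
  · right; exact h.map (algebraMap _ A)

set_option linter.unusedSectionVars false
section len
open scoped Pointwise
variable {S : Type*} [CommRing S] [IsDomain S] [IsNoetherianRing S] [Ring.KrullDimLE 1 S]

theorem length_quot_smul (x : S) (hx : x ≠ 0) (J : Ideal S) :
    Module.length S (S ⧸ (x • J)) = Module.length S (S ⧸ J) + Ring.ord S x :=
  Module.length_eq_add_of_exact _ _
    (Ideal.mulQuot_injective J (mem_nonZeroDivisors_of_ne_zero hx)) (Ideal.quotOfMul_surjective J)
    (Ideal.exact_mulQuot_quotOfMul J)

theorem length_quot_anti {S : Type*} [CommRing S] {I J : Ideal S} (h : I ≤ J) :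
    Module.length S (S ⧸ J) ≤ Module.length S (S ⧸ I) :=
  Module.length_le_of_surjective (Submodule.factor h) (Submodule.factor_surjective h)

theorem length_quot_ne_top {J : Ideal S} (h : J ≠ ⊥) : Module.length S (S ⧸ J) ≠ ⊤ := by
  obtain ⟨t, ht, h0⟩ := Submodule.exists_mem_ne_zero_of_ne_bot h
  have h1 := Ring.ord_ne_top (R := S) (mem_nonZeroDivisors_of_ne_zero h0)
  have h2 : Module.length S (S ⧸ J) ≤ Ring.ord S t :=
    length_quot_anti ((Ideal.span_singleton_le_iff_mem _).2 ht)
  exact ne_top_of_le_ne_top h1 h2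

theorem ord_le_of_smul_le {x y : S} (hx : x ≠ 0) (hy : y ≠ 0) {J : Ideal S} (hJ : J ≠ ⊥)
    (h : y • J ≤ x • J) : Ring.ord S x ≤ Ring.ord S y := by
  have := length_quot_anti h
  rw [length_quot_smul x hx, length_quot_smul y hy] at this
  exact (ENat.add_le_add_iff_left (length_quot_ne_top hJ)).1 this

/-- If `x` divides `y` in an integral extension then `ord x ≤ ord y`. -/
theorem ord_le_of_dvd_integral {A : Type*} [CommRing A] [IsDomain A] [Algebra S A]
    [Algebra.IsIntegral S A] (hinj : Function.Injective (algebraMap S A))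
    {x y : S} (hx : x ≠ 0) (hy : y ≠ 0)
    (h : algebraMap S A x ∣ algebraMap S A y) : Ring.ord S x ≤ Ring.ord S y := by
  obtain ⟨s, hs⟩ := h
  let J : Ideal S :=
    { carrier := {r | ∀ p : Polynomial S, ∃ t, algebraMap S A t = algebraMap S A r * Polynomial.aeval s p}
      add_mem' := by
        intro a b ha hb p
        obtain ⟨t, ht⟩ := ha p
        obtain ⟨u, hu⟩ := hb p
        exact ⟨t + u, by rw [map_add, map_add, ht, hu]; ring⟩
      zero_mem' := fun p => ⟨0, by simp⟩
      smul_mem' := by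
        intro c a ha p
        obtain ⟨t, ht⟩ := ha p
        exact ⟨c * t, by rw [smul_eq_mul, map_mul, map_mul, ht]; ring⟩ }
  obtain ⟨q, hq, hq0⟩ := Algebra.IsIntegral.isIntegral (R := S) s
  have hJ : J ≠ ⊥ := by
    refine (Submodule.ne_bot_iff _).2 ⟨x ^ q.natDegree, ?_, pow_ne_zero _ hx⟩
    intro p
    have e : Polynomial.aeval s p = Polynomial.aeval s (p %ₘ q) := by
      conv_lhs => rw [← Polynomial.modByMonic_add_div p q]
      rw [map_add, map_mul]
      have : Polynomial.aeval s q = 0 := hq0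
      rw [this]; simp
    rw [e, Polynomial.aeval_eq_sum_range, Finset.mul_sum]
    refine ⟨∑ i ∈ Finset.range ((p %ₘ q).natDegree + 1),
      (p %ₘ q).coeff i * (x ^ (q.natDegree - i) * y ^ i), ?_⟩
    rw [map_sum]
    refine Finset.sum_congr rfl fun i hi => ?_
    have hi' : i ≤ q.natDegree :=
      (Nat.lt_succ_iff.1 (Finset.mem_range.1 hi)).trans (Polynomial.natDegree_modByMonic_le p hq)
    rw [map_mul, map_mul, map_pow, map_pow, hs, map_pow, Algebra.smul_def]
    conv_rhs => rw [← Nat.sub_add_cancel hi', pow_add]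
    ring
  refine ord_le_of_smul_le hx hy hJ ?_
  intro w hw
  rw [Submodule.mem_smul_pointwise_iff_exists] at hw ⊢
  obtain ⟨r, hr, rfl⟩ := hw
  obtain ⟨t, ht⟩ := hr Polynomial.X
  rw [Polynomial.aeval_X] at ht
  refine ⟨t, ?_, ?_⟩
  · intro p
    obtain ⟨u, hu⟩ := hr (Polynomial.X * p)
    exact ⟨u, by rw [hu, ht, map_mul, Polynomial.aeval_X]; ring⟩
  · apply hinj
    rw [smul_eq_mul, smul_eq_mul, map_mul, map_mul, ht, hs]; ring

theorem exists_rel [IsLocalRing S] (hf : ¬ IsField S) (a b : S) (hb : b ≠ 0) :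
    ∃ (n : ℕ) (c : Fin (n + 1) → S), (∃ i, IsUnit (c i)) ∧
      ∑ i, c i * (a ^ (i : ℕ) * b ^ (n - i)) = 0 := by
  obtain ⟨x, hxm, hx⟩ := Submodule.exists_mem_ne_zero_of_ne_bot
    (mt IsLocalRing.isField_iff_maximalIdeal_eq.2 hf)
  obtain ⟨n, hn⟩ := ENat.ne_top_iff_exists.1 (Ring.ord_ne_top (R := S) (mem_nonZeroDivisors_of_ne_zero hx))
  refine ⟨n, ?_⟩
  let v : Fin (n + 1) → S := fun i => a ^ (i : ℕ) * b ^ (n - i)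
  let J : Ideal S := Ideal.span (Set.range v)
  have hJ : J ≠ ⊥ := by
    refine (Submodule.ne_bot_iff _).2 ⟨b ^ n, Ideal.subset_span ⟨0, by simp [v]⟩, pow_ne_zero _ hb⟩
  by_contra! hcon
  let F : ℕ → Ideal S := fun k => maximalIdeal S • J ⊔ Submodule.span S (v '' {i | (i : ℕ) < k})
  have hFJ : ∀ k, F k ≤ J := fun k => sup_le (Ideal.mul_le_right)
    (Submodule.span_mono (Set.image_subset_range _ _))
  have hmono : ∀ k, k ≤ n → F k < F (k + 1) := by
    intro k hk
    refine lt_of_le_of_ne (sup_le_sup le_rfl (Submodule.span_mono (Set.image_mono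
      fun i hi => Nat.lt_succ_of_lt hi))) fun heq => ?_
    let k' : Fin (n + 1) := ⟨k, Nat.lt_succ_of_le hk⟩
    have hmem : v k' ∈ F k := by
      rw [heq]
      exact Submodule.mem_sup_right (Submodule.subset_span ⟨k', Nat.lt_succ_self k, rfl⟩)
    obtain ⟨y, hy, z, hz, hyz⟩ := Submodule.mem_sup.1 hmem
    obtain ⟨l, hl, rfl⟩ := (Submodule.mem_ideal_smul_span_iff_exists_sum _ _ _).1 hy
    obtain ⟨r, hr, rfl⟩ := (Finsupp.mem_span_image_iff_linearCombination S).1 hz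
    refine hcon (fun i => l i + r i - (if i = k' then 1 else 0)) ⟨k', ?_⟩ ?_
    · have : r k' = 0 := by
        by_contra h
        have := hr (Finsupp.mem_support_iff.2 h)
        exact lt_irrefl k this
      simp only [this, add_zero, if_true]
      rw [← neg_sub, IsUnit.neg_iff]
      by_contra h
      have h1 : 1 - l k' ∈ maximalIdeal S := h
      exact (Ideal.ne_top_iff_one _).1 (maximalIdeal.isMaximal S).ne_top
        (by simpa using add_mem h1 (hl k'))
    · simp only [sub_mul, add_mul, Finset.sum_sub_distrib, Finset.sum_add_distrib, ite_mul, one_mul,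
        zero_mul, Finset.sum_ite_eq', Finset.mem_univ, if_true]
      rw [sub_eq_zero]
      rw [Finsupp.linearCombination_apply, Finsupp.sum_fintype _ _ (by simp),
        Finsupp.sum_fintype _ _ (by simp)] at hyz
      simpa [v] using hyz
  have hlen : ∀ k, k ≤ n + 1 →
      Module.length S (S ⧸ F k) + k ≤ Module.length S (S ⧸ F 0) := by
    intro k
    induction k with
    | zero => intro; simp
    | succ k ih =>
      intro hk
      refine le_trans ?_ (ih (by omega))
      have h1 : Module.length S (S ⧸ F (k + 1)) + 1 ≤ Module.length S (S ⧸ F k) := by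
        rw [Module.length_quotient, Module.length_quotient]
        exact Order.coheight_add_one_le (hmono k (by omega))
      push_cast
      calc _ = Module.length S (S ⧸ F (k + 1)) + 1 + k := by ring
        _ ≤ _ := by gcongr
  have h1 := hlen (n + 1) le_rfl
  have h2 : Module.length S (S ⧸ F 0) ≤ Module.length S (S ⧸ (x • J)) := by
    apply length_quot_anti
    refine le_trans ?_ le_sup_left
    intro w hw
    obtain ⟨r, hr, rfl⟩ := (Submodule.mem_smul_pointwise_iff_exists _ _ _).1 hw
    exact Submodule.smul_mem_smul hxm hr
  rw [length_quot_smul x hx, ← hn] at h2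
  have h3 := (add_le_add_left (length_quot_anti (hFJ (n + 1))) ((n + 1 : ℕ) : ℕ∞)).trans (h1.trans h2)
  have h4 := (ENat.add_le_add_iff_left (length_quot_ne_top hJ)).1 h3
  have h5 : n + 1 ≤ n := by exact_mod_cast h4
  omega
end len

theorem integral_or_inv {A : Type*} [CommRing A] [IsDomain A] [IsLocalRing A]
    [IsIntegrallyClosed A] {F : Type*} [Field F] [Algebra A F] [IsFractionRing A F] (z : F) :
    ∀ (n : ℕ) (P : Polynomial A), P.natDegree ≤ n → (∃ j, IsUnit (P.coeff j)) →
      Polynomial.aeval z P = 0 → (∃ a : A, algebraMap A F a = z) ∨ ∃ a : A, algebraMap A F a = z⁻¹ := by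
  intro n
  induction n with
  | zero =>
    rintro P hP ⟨j, hj⟩ hz
    exfalso
    rw [Polynomial.eq_C_of_natDegree_le_zero hP] at hz hj
    rw [Polynomial.aeval_C] at hz
    have h0 : P.coeff 0 = 0 := IsFractionRing.injective A F (by simpa using hz)
    rw [h0] at hj
    simp at hj
  | succ n ih =>
    rintro P hP ⟨j, hj⟩ hz
    have hint : IsIntegral A (P.coeff (n + 1) • z) := by
      rcases hP.lt_or_eq with h | h
      · rw [Polynomial.coeff_eq_zero_of_natDegree_lt h, zero_smul]
        exact isIntegral_zero
      · rw [← h]; exact isIntegral_leadingCoeff_smul P z hz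
    obtain ⟨y, hy⟩ := IsIntegrallyClosed.isIntegral_iff.1 hint
    rw [Algebra.smul_def] at hy
    by_cases hc : IsUnit (P.coeff (n + 1))
    · left
      obtain ⟨u, hu⟩ := hc
      refine ⟨↑u⁻¹ * y, ?_⟩
      rw [map_mul, hy, ← hu, ← mul_assoc, ← map_mul]; simp
    by_cases hyu : IsUnit y
    · right
      obtain ⟨u, rfl⟩ := hyu
      refine ⟨P.coeff (n + 1) * ↑u⁻¹, ?_⟩
      apply eq_inv_of_mul_eq_one_left
      rw [map_mul, mul_right_comm, ← hy, ← map_mul]; simp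
    -- reduce the degree
    refine ih (P - Polynomial.monomial (n + 1) (P.coeff (n + 1)) + Polynomial.monomial n y) ?_ ?_ ?_
    · rw [Polynomial.natDegree_le_iff_coeff_eq_zero]
      intro N hN
      simp only [Polynomial.coeff_add, Polynomial.coeff_sub, Polynomial.coeff_monomial]
      rw [if_neg (by omega : ¬ n = N)]
      split_ifs with h
      · subst h; simp
      · rw [Polynomial.coeff_eq_zero_of_natDegree_lt (by omega)]; simp
    · refine ⟨j, ?_⟩
      have hj1 : n + 1 ≠ j := by rintro rfl; exact hc hj
      simp only [Polynomial.coeff_add, Polynomial.coeff_sub, Polynomial.coeff_monomial]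
      rw [if_neg hj1, sub_zero]
      split_ifs with h
      · by_contra hcon
        have h1 : P.coeff j + y ∈ maximalIdeal A := hcon
        have h2 : y ∈ maximalIdeal A := hyu
        exact ((Submodule.add_mem_iff_left _ h2).1 h1) hj
      · simpa using hj
    · rw [map_add, map_sub, hz, Polynomial.aeval_monomial, Polynomial.aeval_monomial, hy]
      ring


theorem krullDimLE_one_of_integral {S A : Type*} [CommRing S] [IsDomain S] [CommRing A] [IsDomain A]
    [Algebra S A] [Algebra.IsIntegral S A] (hinj : Function.Injective (algebraMap S A))
    [Ring.KrullDimLE 1 A] : Ring.KrullDimLE 1 S := by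
  refine Ring.KrullDimLE.mk₁' fun p hp0 hp => ?_
  have : FaithfulSMul S A := (faithfulSMul_iff_algebraMap_injective S A).2 hinj
  obtain ⟨Q, hQ, hQp⟩ := Ideal.exists_ideal_over_prime_of_isIntegral_of_isDomain (S := A) p
    (by rw [(RingHom.injective_iff_ker_eq_bot _).1 hinj]; exact bot_le)
  have hQ0 : Q ≠ ⊥ := by
    rintro rfl
    apply hp0
    rw [← hQp]
    exact (RingHom.injective_iff_ker_eq_bot _).1 hinj
  have := hQ.isMaximal_of_ne_bot hQ0
  rw [← hQp]
  exact Ideal.isMaximal_comap_of_isIntegral_of_isMaximal Q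

section main
variable (R : Type*) [CommRing R] [IsDomain R] [IsNoetherianRing R]
  (A : Type*) [CommRing A] [IsDomain A] [IsLocalRing A] [Algebra R A] [Algebra.IsIntegral R A]
  [FaithfulSMul R A] [Ring.KrullDimLE 1 A]

theorem adjoin_props (s : Set A) (hs : s.Finite) :
    IsNoetherianRing (Algebra.adjoin R s) ∧ IsLocalRing (Algebra.adjoin R s) ∧
    Ring.KrullDimLE 1 (Algebra.adjoin R s) ∧ Algebra.IsIntegral (Algebra.adjoin R s) A := by
  have h1 : Module.Finite R (Algebra.adjoin R s) :=
    Algebra.finite_adjoin_of_finite_of_isIntegral hs fun x _ => Algebra.IsIntegral.isIntegral x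
  have h2 : IsNoetherianRing (Algebra.adjoin R s) := IsNoetherianRing.of_finite R _
  have h3 : Algebra.IsIntegral (Algebra.adjoin R s) A := Algebra.IsIntegral.tower_top R
  have h4 : IsLocalRing (Algebra.adjoin R s) :=
    RingHom.domain_isLocalRing (algebraMap (Algebra.adjoin R s) A)
  have h5 := krullDimLE_one_of_integral (S := Algebra.adjoin R s) (A := A) Subtype.val_injective
  exact ⟨h2, h4, h5, h3⟩

/-- Comparison of powers. -/
theorem exists_pow_assoc [ValuationRing A] (x : R) (hx0 : x ≠ 0)
    (hx : ¬ IsUnit (algebraMap R A x)) (z : A) (hz : z ≠ 0) :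
    ∃ n k : ℕ, 0 < n ∧ Associated (z ^ n) (algebraMap R A x ^ k) := by
  obtain ⟨h1, h2, h3, h4⟩ := adjoin_props R A {z} (Set.toFinite _)
  set S := Algebra.adjoin R {z}
  let y : S := ⟨z, Algebra.subset_adjoin (by simp)⟩
  let x' : S := algebraMap R S x
  have hinj : Function.Injective (algebraMap S A) := Subtype.val_injective
  have hy0 : y ≠ 0 := fun h => hz (congrArg Subtype.val h)
  have hxA : algebraMap S A x' = algebraMap R A x := rfl
  have hyA : algebraMap S A y = z := rfl
  have hxA0 : algebraMap R A x ≠ 0 := by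
    intro h; exact hx0 (FaithfulSMul.algebraMap_injective R A (by simpa using h))
  have hx'0 : x' ≠ 0 := by
    intro h; rw [h] at hxA; exact hxA0 (by rw [← hxA, map_zero])
  have hx'u : ¬ IsUnit x' := fun h => hx (h.map (algebraMap S A))
  have H : ∀ u w : S, u ≠ 0 → w ≠ 0 → algebraMap S A u ∣ algebraMap S A w →
      Ring.ord S u ≤ Ring.ord S w := fun u w hu hw h => ord_le_of_dvd_integral hinj hu hw h
  have nz : ∀ {u : S}, u ≠ 0 → u ∈ nonZeroDivisors S := fun h => mem_nonZeroDivisors_of_ne_zero h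
  obtain ⟨p, hp⟩ := ENat.ne_top_iff_exists.1 (Ring.ord_ne_top (nz hx'0))
  obtain ⟨q, hq⟩ := ENat.ne_top_iff_exists.1 (Ring.ord_ne_top (nz hy0))
  have hp0 : 0 < p := by
    have : Nontrivial (S ⧸ Ideal.span {x'}) :=
      Ideal.Quotient.nontrivial_iff.2 (by rwa [Ne, Ideal.span_singleton_eq_top])
    have h : 0 < Ring.ord S x' := Module.length_pos
    rw [← hp] at h
    exact_mod_cast h
  have hordx : ∀ i : ℕ, Ring.ord S (x' ^ i) = (i * p : ℕ) := fun i => by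
    rw [Ring.ord_pow (nz hx'0), ← hp, nsmul_eq_mul]; push_cast; rfl
  have hordy : ∀ i : ℕ, Ring.ord S (y ^ i) = (i * q : ℕ) := fun i => by
    rw [Ring.ord_pow (nz hy0), ← hq, nsmul_eq_mul]; push_cast; rfl
  have nilp : ∀ s : A, ¬ IsUnit s → ∃ N : ℕ, algebraMap R A x ∣ s ^ N := by
    intro s hs
    have : s ∈ (Ideal.span {algebraMap R A x}).radical := by
      rw [Ideal.radical_eq_sInf, Submodule.mem_sInf]
      rintro Q ⟨hQ, hQp⟩
      have hQ0 : Q ≠ ⊥ := by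
        rintro rfl
        exact hxA0 (hQ (Ideal.mem_span_singleton_self _))
      rw [IsLocalRing.eq_maximalIdeal (hQp.isMaximal_of_ne_bot hQ0)]
      exact hs
    obtain ⟨N, hN⟩ := this
    exact ⟨N, Ideal.mem_span_singleton.1 hN⟩
  refine ⟨p, q, hp0, ?_⟩
  rcases ValuationRing.dvd_total (z ^ p) (algebraMap R A x ^ q) with ⟨s, hs⟩ | ⟨s, hs⟩
  · by_cases hu : IsUnit s
    · exact ⟨hu.unit, hs.symm⟩
    exfalso
    obtain ⟨N, t, ht⟩ := nilp s hu
    have := H (y ^ (p * N) * x') (x' ^ (q * N)) (mul_ne_zero (pow_ne_zero _ hy0) hx'0)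
      (pow_ne_zero _ hx'0) ⟨t, by
        rw [map_mul, map_pow, map_pow, hxA, hyA, pow_mul, hs, mul_pow, ht, ← pow_mul]; ring⟩
    rw [Ring.ord_mul S (nz hx'0), hordy, hordx, ← hp] at this
    norm_cast at this
    nlinarith
  · by_cases hu : IsUnit s
    · exact Associated.symm ⟨hu.unit, hs.symm⟩
    exfalso
    obtain ⟨N, t, ht⟩ := nilp s hu
    have := H (x' ^ (q * N) * x') (y ^ (p * N)) (mul_ne_zero (pow_ne_zero _ hx'0) hx'0)
      (pow_ne_zero _ hy0) ⟨t, by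
        rw [map_mul, map_pow, map_pow, hxA, hyA, pow_mul z, hs, mul_pow, ht, ← pow_mul]; ring⟩
    rw [Ring.ord_mul S (nz hx'0), hordy, hordx, ← hp] at this
    norm_cast at this
    nlinarith
end main

theorem field_aux1 {K : Type*} [Field K] (u w c p : K) (hw : w ≠ 0) :
    u * w * (c * (p / w)) = c * (p * u) := by field_simp

theorem field_aux2 {K : Type*} [Field K] (a b : K) (hb : b ≠ 0) : a = b * (a / b) := by
  field_simp

theorem field_aux3 {K : Type*} [Field K] (a b : K) (ha : a ≠ 0) : b = a * (a / b)⁻¹ := by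
  field_simp

theorem valuationRing_of_props (R : Type*) [CommRing R] [IsDomain R] [IsNoetherianRing R]
    (A : Type*) [CommRing A] [IsDomain A] [IsLocalRing A] [Algebra R A] [Algebra.IsIntegral R A]
    [FaithfulSMul R A] [Ring.KrullDimLE 1 A] [IsIntegrallyClosed A] (hf : ¬ IsField A) : ValuationRing A := by
  rw [ValuationRing.iff_dvd_total]
  refine ⟨fun a b => ?_⟩
  by_cases hb : b = 0
  · left; rw [hb]; exact dvd_zero a
  by_cases ha : a = 0
  · right; rw [ha]; exact dvd_zero b
  obtain ⟨h1, h2, h3, h4⟩ := adjoin_props R A {a, b} (Set.toFinite _)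
  set S := Algebra.adjoin R {a, b}
  let a' : S := ⟨a, Algebra.subset_adjoin (by simp)⟩
  let b' : S := ⟨b, Algebra.subset_adjoin (by simp)⟩
  have hS : ¬ IsField S := fun h => hf
    ((Algebra.IsIntegral.isField_iff_isField (R := S) (S := A) Subtype.val_injective).1 h)
  obtain ⟨n, c, ⟨i, hi⟩, hc⟩ := exists_rel hS a' b' (by
    intro h; exact hb (congrArg Subtype.val h))
  let F := FractionRing A
  let z : F := algebraMap A F a / algebraMap A F b
  have hbF : algebraMap A F b ≠ 0 := by simpa using hb
  have haF : algebraMap A F a ≠ 0 := by simpa using ha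
  let P : Polynomial A := ∑ i : Fin (n + 1), Polynomial.monomial (i : ℕ) (c i : A)
  have hP : Polynomial.aeval z P = 0 := by
    have h5 : ∑ i, (c i : A) * (a ^ (i : ℕ) * b ^ (n - i)) = 0 := by
      have := congrArg (algebraMap S A) hc
      simpa using this
    have h6 := congrArg (algebraMap A F) h5
    simp only [map_sum, map_mul, map_pow, map_zero] at h6
    simp only [P, map_sum, Polynomial.aeval_monomial]
    have h7 : algebraMap A F b ^ n * ∑ i : Fin (n + 1), algebraMap A F (c i) * z ^ (i : ℕ) = 0 := by
      rw [← h6, Finset.mul_sum]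
      refine Finset.sum_congr rfl fun i _ => ?_
      have : algebraMap A F b ^ n = algebraMap A F b ^ (n - i) * algebraMap A F b ^ (i : ℕ) := by
        rw [← pow_add, Nat.sub_add_cancel (by omega)]
      rw [this]
      simp only [z, div_pow]
      exact field_aux1 _ _ _ _ (pow_ne_zero _ hbF)
    exact (mul_eq_zero.1 h7).resolve_left (pow_ne_zero _ hbF)
  have hcoef : IsUnit (P.coeff i) := by
    have : P.coeff i = c i := by
      simp only [P, Polynomial.finsetSum_coeff, Polynomial.coeff_monomial]
      rw [Finset.sum_eq_single i]
      · simp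
      · intro j _ hj
        rw [if_neg]
        exact fun h => hj (Fin.ext h)
      · simp
    rw [this]
    exact hi.map (algebraMap S A)
  rcases integral_or_inv z P.natDegree P le_rfl ⟨i, hcoef⟩ hP with ⟨t, ht⟩ | ⟨t, ht⟩
  · right
    refine ⟨t, IsFractionRing.injective A F ?_⟩
    rw [map_mul, ht]; exact field_aux2 _ _ hbF
  · left
    refine ⟨t, IsFractionRing.injective A F ?_⟩
    rw [map_mul, ht]; exact field_aux3 _ _ haF


theorem exists_ratValuation {A : Type*} [CommRing A] [IsDomain A] [ValuationRing A]
    {F : Type*} [Field F] [Algebra A F] [IsFractionRing A F]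
    (x : A) (hx0 : x ≠ 0) (hx : ¬ IsUnit x)
    (hpow : ∀ z : A, z ≠ 0 → ∃ n k : ℕ, 0 < n ∧ Associated (z ^ n) (x ^ k))
    (hroot : ∀ n : ℕ, 0 < n → ∃ b : A, b ^ n = x) :
    ∃ v : Valuation F (WithZero (Multiplicative ℚ)),
      Function.Surjective v ∧ ∀ z : F, v z ≤ 1 ↔ z ∈ Set.range (algebraMap A F) := by
  classical
  let V := ValuationRing.valuation A F
  have hVle : ∀ z : F, V z ≤ 1 ↔ z ∈ Set.range (algebraMap A F) := fun z =>
    ValuationRing.mem_integer_iff A F z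
  have hVA : ∀ a : A, V (algebraMap A F a) ≤ 1 := fun a => (hVle _).2 ⟨a, rfl⟩
  have hVu : ∀ a : A, IsUnit a → V (algebraMap A F a) = 1 := by
    rintro _ ⟨u, rfl⟩
    refine le_antisymm (hVA _) ?_
    have h1 : V (algebraMap A F ↑u) * V (algebraMap A F ↑u⁻¹) = 1 := by
      rw [← map_mul, ← map_mul]; simp
    calc 1 = V (algebraMap A F ↑u) * V (algebraMap A F ↑u⁻¹) := h1.symm
      _ ≤ V (algebraMap A F ↑u) * 1 := mul_le_mul_right (hVA _) _
      _ = _ := mul_one _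
  let X : F := algebraMap A F x
  have hX0 : X ≠ 0 := by simpa [X] using hx0
  have hX1 : V X < 1 := by
    refine lt_of_le_of_ne (hVA _) fun h => hx ?_
    have : V X⁻¹ ≤ 1 := by rw [map_inv₀, h, inv_one]
    obtain ⟨t, ht⟩ := (hVle _).1 this
    refine IsUnit.of_mul_eq_one t (IsFractionRing.injective A F ?_)
    rw [map_mul, ht, map_one]; exact mul_inv_cancel₀ hX0
  have hVX0 : 0 < V X := zero_lt_iff.2 ((Valuation.ne_zero_iff _).2 hX0)
  have hex : ∀ z : F, z ≠ 0 → ∃ (n : ℕ) (k : ℤ), 0 < n ∧ V z ^ n = V X ^ k := by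
    intro z hz
    have hA : ∀ a : A, a ≠ 0 → ∃ (n k : ℕ), 0 < n ∧ V (algebraMap A F a) ^ n = V X ^ k := by
      intro a ha
      obtain ⟨n, k, hn, u, hu⟩ := hpow a ha
      refine ⟨n, k, hn, ?_⟩
      rw [← map_pow, ← map_pow, ← map_pow, ← map_pow, ← hu, map_mul, map_mul, hVu _ u.isUnit, mul_one]
    obtain ⟨a, b, hb, rfl⟩ := IsFractionRing.div_surjective (A := A) z
    have hb0 : b ≠ 0 := nonZeroDivisors.ne_zero hb
    have ha0 : a ≠ 0 := by rintro rfl; simp at hz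
    obtain ⟨n, k, hn, h1⟩ := hA a ha0
    obtain ⟨m, l, hm, h2⟩ := hA b hb0
    refine ⟨n * m, k * m - l * n, Nat.mul_pos hn hm, ?_⟩
    rw [map_div₀, div_pow, pow_mul, h1, mul_comm n m, pow_mul, h2, zpow_sub₀ hVX0.ne']
    norm_cast
    rw [pow_mul, pow_mul]
  choose! N K hN hNK using hex
  let e : F → ℚ := fun z => -((K z : ℚ) / (N z : ℚ))
  -- comparison
  have cmp : ∀ (z w : F) (n m : ℕ) (k l : ℤ), 0 < n → 0 < m → V z ^ n = V X ^ k →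
      V w ^ m = V X ^ l → (V z ≤ V w ↔ -((k : ℚ) / n) ≤ -((l : ℚ) / m)) := by
    intro z w n m k l hn hm h1 h2
    have hn' : (0 : ℚ) < n := by exact_mod_cast hn
    have hm' : (0 : ℚ) < m := by exact_mod_cast hm
    rw [neg_le_neg_iff, div_le_div_iff₀ hm' hn',
      ← pow_le_pow_iff_left₀ zero_le zero_le (Nat.mul_pos hn hm).ne', pow_mul, h1,
      mul_comm n m, pow_mul, h2, ← zpow_natCast, ← zpow_natCast, ← zpow_mul, ← zpow_mul,
      zpow_le_zpow_iff_right_of_lt_one₀ hVX0 hX1]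
    exact_mod_cast Iff.rfl
  have hle : ∀ z w : F, z ≠ 0 → w ≠ 0 → (V z ≤ V w ↔ e z ≤ e w) := fun z w hz hw =>
    cmp z w _ _ _ _ (hN z hz) (hN w hw) (hNK z hz) (hNK w hw)
  have huniq : ∀ (z : F) (n : ℕ) (k : ℤ), z ≠ 0 → 0 < n → V z ^ n = V X ^ k →
      e z = -((k : ℚ) / n) := by
    intro z n k hz hn h
    exact le_antisymm ((cmp z z _ _ _ _ (hN z hz) hn (hNK z hz) h).1 le_rfl)
      ((cmp z z _ _ _ _ hn (hN z hz) h (hNK z hz)).1 le_rfl)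
  have hemul : ∀ z w : F, z ≠ 0 → w ≠ 0 → e (z * w) = e z + e w := by
    intro z w hz hw
    have hn' : (N z : ℚ) ≠ 0 := by exact_mod_cast (hN z hz).ne'
    have hm' : (N w : ℚ) ≠ 0 := by exact_mod_cast (hN w hw).ne'
    rw [huniq (z * w) (N z * N w) (K z * N w + K w * N z) (mul_ne_zero hz hw)
      (Nat.mul_pos (hN z hz) (hN w hw))]
    · simp only [e]; push_cast; field_simp; ring
    · rw [map_mul, mul_pow, pow_mul, hNK z hz, mul_comm (N z), pow_mul, hNK w hw,
        zpow_add₀ hVX0.ne', zpow_mul, zpow_mul]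
      norm_cast
  have he1 : e 1 = 0 := by
    rw [huniq 1 1 0 one_ne_zero one_pos (by simp)]; simp
  let g : F → WithZero (Multiplicative ℚ) := fun z =>
    if z = 0 then 0 else ((Multiplicative.ofAdd (e z) : Multiplicative ℚ) : WithZero (Multiplicative ℚ))
  have hg : ∀ z, z ≠ 0 → g z = ((Multiplicative.ofAdd (e z) : Multiplicative ℚ) : WithZero (Multiplicative ℚ)) :=
    fun z hz => if_neg hz
  have hg0 : g 0 = 0 := if_pos rfl
  have hgle : ∀ z w : F, V z ≤ V w → g z ≤ g w := by
    intro z w h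
    by_cases hz : z = 0
    · rw [hz, hg0]; exact zero_le
    have hw : w ≠ 0 := by
      rintro rfl
      rw [map_zero, le_zero_iff, map_eq_zero] at h
      exact hz h
    rw [hg z hz, hg w hw, WithZero.coe_le_coe]
    exact (hle z w hz hw).1 h
  let v : Valuation F (WithZero (Multiplicative ℚ)) :=
    { toFun := g
      map_zero' := hg0
      map_one' := by rw [hg 1 one_ne_zero, he1]; rfl
      map_mul' := by
        intro z w
        by_cases hz : z = 0
        · simp [hz, hg0]
        by_cases hw : w = 0
        · simp [hw, hg0]
        rw [hg _ (mul_ne_zero hz hw), hg z hz, hg w hw, hemul z w hz hw, ofAdd_add, WithZero.coe_mul]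
      map_add_le_max' := by
        intro z w
        rcases le_max_iff.1 (V.map_add z w) with h | h
        · exact (hgle _ _ h).trans (le_max_left _ _)
        · exact (hgle _ _ h).trans (le_max_right _ _) }
  refine ⟨v, ?_, ?_⟩
  · intro y
    rcases eq_or_ne y 0 with rfl | hy
    · exact ⟨0, hg0⟩
    obtain ⟨r, rfl⟩ := WithZero.ne_zero_iff_exists.1 hy
    let r' : ℚ := Multiplicative.toAdd r
    obtain ⟨b, hb⟩ := hroot r'.den r'.pos
    let B : F := algebraMap A F b
    have hB : B ^ r'.den = X := by simp only [B, X]; rw [← map_pow, hb]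
    have hB0 : B ≠ 0 := by
      intro h
      rw [h, zero_pow r'.den_nz] at hB
      exact hX0 hB.symm
    refine ⟨B ^ (-r'.num), ?_⟩
    change g _ = _
    have hne : B ^ (-r'.num) ≠ 0 := zpow_ne_zero _ hB0
    rw [hg _ hne, huniq _ r'.den (-r'.num) hne r'.pos]
    · push_cast
      rw [neg_div, neg_neg, Rat.num_div_den]; rfl
    · have h : (B ^ (-r'.num)) ^ r'.den = X ^ (-r'.num) := by
        rw [← hB, ← zpow_natCast, ← zpow_natCast, ← zpow_mul, ← zpow_mul, mul_comm]
      rw [← map_pow, h, map_zpow₀]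
  · intro z
    rw [← hVle]
    change g z ≤ 1 ↔ _
    by_cases hz : z = 0
    · simp [hz, hg0]
    have h1 : V z ≤ 1 ↔ V z ≤ V 1 := by rw [map_one]
    rw [h1, hle z 1 hz one_ne_zero, he1, hg z hz]
    exact WithZero.coe_le_coe

theorem dim_le_one_of_valuationRing (R : Type*) [CommRing R] [IsDomain R] [IsNoetherianRing R]
    (A : Type*) [CommRing A] [IsDomain A] [Algebra R A] [Algebra.IsIntegral R A]
    [FaithfulSMul R A] [ValuationRing A] : ringKrullDim A ≤ 1 := by
  have hR : Ring.KrullDimLE 1 R := by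
    refine Ring.KrullDimLE.mk₁' fun p hp0 hp => ?_
    by_contra hmax
    obtain ⟨m, hm, hpm⟩ := Ideal.exists_le_maximal p hp.ne_top
    have hne : p ≠ m := by rintro rfl; exact hmax hm
    obtain ⟨x, hxm, hxp⟩ := SetLike.exists_of_lt (lt_of_le_of_ne hpm hne)
    have hspan : Ideal.span {x} ≤ m := (Ideal.span_singleton_le_iff_mem _).2 hxm
    obtain ⟨q, hq, -⟩ := Ideal.exists_minimalPrimes_le hspan
    have hqp : q.IsPrime := hq.1.1
    have hxq : x ∈ q := hq.1.2 (Ideal.mem_span_singleton_self x)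
    have hht := Ideal.height_le_one_of_isPrincipal_of_mem_minimalPrimes (Ideal.span {x}) q hq
    have hinj := FaithfulSMul.algebraMap_injective R A
    have hover : ∀ p : Ideal R, p.IsPrime → ∃ Q : Ideal A, Q.comap (algebraMap R A) = p := by
      intro p hp
      obtain ⟨Q, _, h⟩ := Ideal.exists_ideal_over_prime_of_isIntegral_of_isDomain (S := A) p
        (by rw [(RingHom.injective_iff_ker_eq_bot _).1 hinj]; exact bot_le)
      exact ⟨Q, h⟩
    obtain ⟨P', hP'⟩ := hover p hp
    obtain ⟨Q', hQ'⟩ := hover q hqp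
    have hlt : p < q := by
      rcases (ValuationRing.iff_ideal_total.1 (inferInstance : ValuationRing A)).total P' Q' with h | h
      · refine lt_of_le_of_ne ?_ ?_
        · rw [← hP', ← hQ']; exact Ideal.comap_mono h
        · rintro rfl; exact hxp hxq
      · exfalso
        apply hxp
        have : q ≤ p := by rw [← hP', ← hQ']; exact Ideal.comap_mono h
        exact this hxq
    have h1 : (⊥ : Ideal R).height + 1 ≤ p.height := Ideal.height_add_one_le_of_lt_of_isPrime (bot_lt_iff_ne_bot.2 hp0)
    have h2 : p.height + 1 ≤ q.height := Ideal.height_add_one_le_of_lt_of_isPrime hlt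
    have h3 := (add_le_add_left h1 1).trans (h2.trans hht)
    rw [Ideal.height_bot] at h3
    have h4 : (0 + 1 + 1 : ℕ) ≤ 1 := by exact_mod_cast h3
    omega
  have hA : Ring.KrullDimLE 1 A := by
    refine Ring.KrullDimLE.mk₁' fun Q hQ0 hQ => ?_
    have h1 : Q.comap (algebraMap R A) ≠ ⊥ := Ideal.IsIntegral.comap_ne_bot R hQ0
    have : (Q.comap (algebraMap R A)).IsMaximal :=
      Ideal.isMaximal_of_isPrime_of_ne_bot _ h1
    exact Ideal.isMaximal_of_isIntegral_of_isMaximal_comap Q this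
  exact Order.krullDimLE_iff _ _ |>.1 hA

end RPlusAux

/-- Let `(R, m)` be a Noetherian complete local domain.
(i) If `dim R⁺ = 1` then `R⁺` is a valuation domain whose value group is `ℚ`: there is
a valuation on the field of fractions of `R⁺` with valuation ring `R⁺` and value group
`ℚ`. (ii) Conversely, if `R⁺` is a valuation domain then `dim R⁺ ≤ 1`. -/
theorem stmt_13 (R : Type u) [CommRing R] [IsDomain R] [IsNoetherianRing R]
    [IsLocalRing R] [IsAdicComplete (IsLocalRing.maximalIdeal R) R] :
    (ringKrullDim (RPlus R) = 1 →
      ValuationRing (RPlus R) ∧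
      ∃ v : Valuation (FractionRing (RPlus R)) (WithZero (Multiplicative ℚ)),
        Function.Surjective v ∧
        ∀ z : FractionRing (RPlus R),
          v z ≤ 1 ↔ z ∈ Set.range (algebraMap (RPlus R) (FractionRing (RPlus R)))) ∧
    (ValuationRing (RPlus R) → ringKrullDim (RPlus R) ≤ 1) := by
  have hint : Algebra.IsIntegral R (RPlus R) := inferInstance
  have hinj0 : Function.Injective (algebraMap R (AlgebraicClosure (FractionRing R))) := by
    rw [IsScalarTower.algebraMap_eq R (FractionRing R) (AlgebraicClosure (FractionRing R))]
    exact (algebraMap (FractionRing R) (AlgebraicClosure (FractionRing R))).injective.comp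
      (IsFractionRing.injective R (FractionRing R))
  have hfaith : FaithfulSMul R (RPlus R) :=
    (faithfulSMul_iff_algebraMap_injective R (RPlus R)).2 fun a b h =>
      hinj0 (congrArg Subtype.val h)
  refine ⟨fun hdim => ?_, fun hV => dim_le_one_of_valuationRing R (RPlus R)⟩
  have hloc : IsLocalRing (RPlus R) := isLocalRing_of_integral R (RPlus R)
  have hkd : Ring.KrullDimLE 1 (RPlus R) := (Order.krullDimLE_iff _ _).2 (le_of_eq hdim)
  have hnf : ¬ IsField (RPlus R) := by
    intro h
    rw [ringKrullDim_eq_zero_of_isField h] at hdim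
    exact zero_ne_one hdim
  have hic : IsIntegrallyClosed (RPlus R) := by
    have halg : Algebra.IsAlgebraic R (AlgebraicClosure (FractionRing R)) :=
      (IsFractionRing.comap_isAlgebraic_iff (K := FractionRing R)).mpr inferInstance
    have hfr : IsFractionRing (RPlus R) (AlgebraicClosure (FractionRing R)) :=
      integralClosure.isFractionRing_of_algebraic fun x hx => hinj0 (by rw [hx, map_zero])
    refine (isIntegrallyClosed_iff (AlgebraicClosure (FractionRing R))).2 fun {x} hx => ?_
    exact ⟨⟨x, isIntegral_trans (R := R) x hx⟩, rfl⟩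
  have hVR : ValuationRing (RPlus R) := valuationRing_of_props R (RPlus R) hnf
  refine ⟨hVR, ?_⟩
  have hRnf : ¬ IsField R := fun h => hnf
    ((Algebra.IsIntegral.isField_iff_isField (R := R) (S := RPlus R)
      (FaithfulSMul.algebraMap_injective _ _)).1 h)
  obtain ⟨x, hxm, hx⟩ := Submodule.exists_mem_ne_zero_of_ne_bot
    (mt IsLocalRing.isField_iff_maximalIdeal_eq.2 hRnf)
  have hxu : ¬ IsUnit (algebraMap R (RPlus R) x) := fun h =>
    hxm (IsUnit.of_map (algebraMap R (RPlus R)) x h)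
  refine exists_ratValuation (algebraMap R (RPlus R) x) ?_ hxu
    (exists_pow_assoc R (RPlus R) x hx hxu) ?_
  · intro h
    exact hx (FaithfulSMul.algebraMap_injective R (RPlus R) (by simpa using h))
  · intro n hn
    obtain ⟨b, hb⟩ := IsAlgClosed.exists_pow_nat_eq
      (algebraMap R (AlgebraicClosure (FractionRing R)) x) hn
    refine ⟨⟨b, ?_⟩, Subtype.ext hb⟩
    exact IsIntegral.of_pow hn (by rw [hb]; exact isIntegral_algebraMap)
end

section
/- Let (R, m) be a one-dimensional Noetherian complete local domain and let v : R^+ → ℚ ∪ {∞} be a valuation that is nonnegative on R^+ and strictly positive on the ideal mR^+. Let m_{R^+} denote the unique maximal ideal of the quasi-local ring R^+. Then an R^+-module M is almost zero with respect to v if and only if m_{R^+}·M = 0. -/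
set_option synthInstance.maxHeartbeats 400000
set_option maxHeartbeats 1000000

universe u

open Polynomial

lemma length_le_of_gens {R Q : Type*} [CommRing R] [AddCommGroup Q] [Module R Q] (x : R) (n : ℕ) (b : Fin n → Q)
    (hb : Submodule.span R (Set.range b) = ⊤) (hx : ∀ i, x • b i = 0) :
    Module.length R Q ≤ n * Module.length R (R ⧸ Ideal.span {x}) := by
  have hk : ∀ i, Ideal.span {x} ≤ LinearMap.ker (LinearMap.toSpanSingleton R Q (b i)) := by
    intro i
    rw [Ideal.span_le]
    simp [hx]
  let g : (Fin n → R ⧸ Ideal.span {x}) →ₗ[R] Q :=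
    ∑ i, (Submodule.liftQ (Ideal.span {x}) (LinearMap.toSpanSingleton R Q (b i)) (hk i)) ∘ₗ
      LinearMap.proj i
  have hg : Function.Surjective g := by
    rw [← LinearMap.range_eq_top, ← top_le_iff, ← hb, Submodule.span_le]
    rintro _ ⟨i, rfl⟩
    refine ⟨Pi.single i (Submodule.Quotient.mk 1), ?_⟩
    simp only [g, LinearMap.sum_apply, LinearMap.comp_apply, LinearMap.proj_apply]
    rw [Finset.sum_eq_single i]
    · rw [Pi.single_eq_same, Submodule.liftQ_apply]; simp
    · intro j _ hj
      rw [Pi.single_eq_of_ne hj, map_zero]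
    · simp
  have := Module.length_le_of_surjective g hg
  simpa using this

lemma length_quot_le {R M : Type*} [CommRing R] [AddCommGroup M] [Module R M] (x c : R)
    (hx : ∀ y : M, x • y = 0 → y = 0) (hc : Module.length R (R ⧸ Ideal.span {c}) ≠ ⊤)
    (d n : ℕ) (a : Fin n → M) (b : Fin d → M) (ha : Submodule.span R (Set.range a) = ⊤)
    (hab : ∀ i, c • a i ∈ Submodule.span R (Set.range b)) :
    Module.length R (M ⧸ LinearMap.range (LinearMap.lsmul R M x)) ≤
      d * Module.length R (R ⧸ Ideal.span {x}) := by
  set N := Submodule.span R (Set.range b) with hN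
  have hMN : Module.length R (M ⧸ N) ≠ ⊤ := by
    have := length_le_of_gens (Q := M ⧸ N) c n (fun i => N.mkQ (a i)) (by
      have : Set.range (fun i => N.mkQ (a i)) = N.mkQ '' Set.range a := by
        rw [← Set.range_comp]; rfl
      rw [this, ← Submodule.map_span, ha, Submodule.map_top, Submodule.range_mkQ]) (by
      intro i
      rw [← map_smul, Submodule.mkQ_apply, Submodule.Quotient.mk_eq_zero]
      exact hab i)
    refine ne_top_of_le_ne_top ?_ this
    obtain ⟨t, ht⟩ := ENat.ne_top_iff_exists.mp hc
    rw [← ht]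
    exact_mod_cast ENat.natCast_ne_top (n * t)
  let μ := LinearMap.lsmul R M x
  let xN := N.map μ
  have hle : xN ≤ N := by
    rintro _ ⟨y, hy, rfl⟩
    exact N.smul_mem x hy
  have hle2 : xN ≤ LinearMap.range μ := LinearMap.map_le_range
  -- first sequence
  let f1 : (M ⧸ N) →ₗ[R] (M ⧸ xN) := Submodule.mapQ N xN μ (Submodule.le_comap_map _ _)
  have e1 := Module.length_eq_add_of_exact f1 (Submodule.factor hle2) (by
      rw [← LinearMap.ker_eq_bot, LinearMap.ker_eq_bot']
      intro y hy
      obtain ⟨y, rfl⟩ := N.mkQ_surjective y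
      simp only [f1, Submodule.mkQ_apply, Submodule.mapQ_apply, Submodule.Quotient.mk_eq_zero] at hy
      obtain ⟨z, hz, hzy⟩ := hy
      have : y - z = 0 := hx _ (by
        have : x • z = x • y := hzy
        rw [smul_sub, this, sub_self])
      rw [sub_eq_zero] at this
      subst this
      simpa using hz)
    (Submodule.factor_surjective hle2) (by
      intro y
      obtain ⟨y, rfl⟩ := xN.mkQ_surjective y
      constructor
      · intro hy
        have : y ∈ LinearMap.range μ := by simpa using hy
        obtain ⟨z, rfl⟩ := this
        exact ⟨N.mkQ z, by simp [f1]⟩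
      · rintro ⟨z, hz⟩
        obtain ⟨z, rfl⟩ := N.mkQ_surjective z
        rw [← hz]
        simp [f1])
  -- second
  let g := Submodule.factor hle
  have e2 := Module.length_eq_add_of_exact (LinearMap.ker g).subtype g
    (Submodule.subtype_injective _) (Submodule.factor_surjective hle)
    (LinearMap.exact_subtype_ker_map g)
  have hker : LinearMap.ker g = N.map xN.mkQ := by
    ext y
    obtain ⟨y, rfl⟩ := xN.mkQ_surjective y
    constructor
    · intro hy
      have : y ∈ N := by simpa [g] using hy
      exact ⟨y, this, rfl⟩
    · rintro ⟨z, hz, hzy⟩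
      rw [← hzy]
      simpa [g] using hz
  have hbk : ∀ i, xN.mkQ (b i) ∈ LinearMap.ker g := by
    intro i
    rw [hker]
    exact ⟨b i, Submodule.subset_span ⟨i, rfl⟩, rfl⟩
  have e3 := length_le_of_gens (Q := LinearMap.ker g) x d (fun i => ⟨xN.mkQ (b i), hbk i⟩) (by
      apply Submodule.map_injective_of_injective (LinearMap.ker g).injective_subtype
      rw [Submodule.map_span, Submodule.map_top, Submodule.range_subtype, ← Set.range_comp]
      refine Eq.trans ?_ hker.symm
      refine Eq.trans ?_ (Submodule.map_span xN.mkQ (Set.range b)).symm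
      rw [← Set.range_comp]
      rfl) (by
      intro i
      ext
      simp only [Submodule.coe_smul, ← map_smul, Submodule.coe_zero]
      rw [Submodule.mkQ_apply, Submodule.Quotient.mk_eq_zero]
      exact ⟨b i, Submodule.subset_span ⟨i, rfl⟩, rfl⟩)
  rw [e2] at e1
  have e4 : Module.length R (LinearMap.ker g) = Module.length R (M ⧸ LinearMap.range μ) := by
    rw [add_comm] at e1
    exact (ENat.add_right_injective_of_ne_top hMN) e1
  exact e4 ▸ e3

lemma exists_unit_coeff (R : Type*) [CommRing R] [IsDomain R] [IsNoetherianRing R]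
    [IsLocalRing R] [Ring.KrullDimLE 1 R] (x : R) (hx0 : x ≠ 0) (hxm : x ∈ IsLocalRing.maximalIdeal R)
    (K : Type*) [Field K] [Algebra R K] [FaithfulSMul R K] (f : K) (hf : IsAlgebraic R f) :
    ∃ p : R[X], aeval f p = 0 ∧ ∃ i, IsUnit (p.coeff i) := by
  by_contra! hcon
  obtain ⟨q, hq0, hq⟩ := hf
  have fl : ∀ c : R, c ≠ 0 → Module.length R (R ⧸ Ideal.span {c}) ≠ ⊤ := fun c hc =>
    Module.length_ne_top_iff.mpr
      (isFiniteLength_quotient_span_singleton R (mem_nonZeroDivisors_of_ne_zero hc))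
  set d := q.natDegree with hd
  set c := q.leadingCoeff with hcdef
  have hc : c ≠ 0 := by simpa [hcdef] using hq0
  obtain ⟨L, hL⟩ := ENat.ne_top_iff_exists.mp (fl x hx0)
  let n := d * L + d + 1
  have hnd : d ≤ n := by simp only [n]; omega
  let φ : (Fin n → R) →ₗ[R] K := Fintype.linearCombination R (fun i : Fin n => f ^ (i : ℕ))
  let M := (Fin n → R) ⧸ LinearMap.ker φ
  let ψ : M →ₗ[R] K := (LinearMap.ker φ).liftQ φ le_rfl
  have hψ : Function.Injective ψ := by
    rw [← LinearMap.ker_eq_bot]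
    exact Submodule.ker_liftQ_eq_bot _ _ _ le_rfl
  let e : Fin n → M := fun i => (LinearMap.ker φ).mkQ (Pi.single i 1)
  have hψe : ∀ i, ψ (e i) = f ^ (i : ℕ) := by
    intro i
    change φ (Pi.single i 1) = _
    simp [φ]
  have hKN : ∀ i : ℕ, c ^ i • f ^ i ∈ Submodule.span R (Set.range (fun j : Fin d => f ^ (j : ℕ))) := by
    intro i
    induction i using Nat.strong_induction_on with
    | _ i ih =>
    by_cases hi : i < d
    · exact Submodule.smul_mem _ _ (Submodule.subset_span ⟨⟨i, hi⟩, rfl⟩)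
    · push Not at hi
      have hd0 : d ≠ 0 := by
        intro h0
        rw [Polynomial.eq_C_of_natDegree_eq_zero (p := q) h0, aeval_C] at hq
        have : q.coeff 0 = 0 := (FaithfulSMul.algebraMap_eq_zero_iff R K).mp hq
        apply hc
        rw [hcdef, leadingCoeff, ← hd, h0, this]
      have h1 : c • f ^ d = - ∑ j ∈ Finset.range d, q.coeff j • f ^ j := by
        rw [aeval_eq_sum_range, Finset.sum_range_succ] at hq
        rw [eq_neg_iff_add_eq_zero, add_comm]
        exact hq
      have h2 : c ^ i • f ^ i = - ∑ j ∈ Finset.range d, (q.coeff j * c ^ (d - 1 - j)) • (c ^ (i - d + j) • f ^ (i - d + j)) := by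
        have : c ^ i • f ^ i = (c ^ (i - 1) • f ^ (i - d)) * (c • f ^ d) := by
          rw [smul_mul_smul_comm, ← pow_succ, ← pow_add]
          congr 2 <;> omega
        rw [this, h1, mul_neg, Finset.mul_sum]
        congr 1
        apply Finset.sum_congr rfl
        intro j hj
        rw [Finset.mem_range] at hj
        rw [smul_mul_smul_comm, smul_smul, ← pow_add, mul_assoc, ← pow_add, mul_comm]
        congr 3; omega
      rw [h2]
      refine Submodule.neg_mem _ (Submodule.sum_mem _ fun j hj => Submodule.smul_mem _ _ (ih _ ?_))
      rw [Finset.mem_range] at hj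
      omega
  have key := length_quot_le (M := M) x (c ^ n) (by
      intro y hy
      apply hψ
      have : x • ψ y = 0 := by rw [← map_smul, hy, map_zero]
      rw [Algebra.smul_def, mul_eq_zero, FaithfulSMul.algebraMap_eq_zero_iff] at this
      rw [map_zero]
      exact this.resolve_left hx0) (fl _ (pow_ne_zero _ hc)) d n e
      (fun j => e (Fin.castLE hnd j)) (by
      have : Set.range e = (LinearMap.ker φ).mkQ '' Set.range (fun i => Pi.single i 1) := by
        rw [← Set.range_comp]; rfl
      rw [this, ← Submodule.map_span]
      have h2 : Submodule.span R (Set.range (fun i : Fin n => (Pi.single i 1 : Fin n → R))) = ⊤ := by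
        have := (Pi.basisFun R (Fin n)).span_eq
        rw [← this]
        congr 2
        funext i
        simp
      rw [h2, Submodule.map_top, Submodule.range_mkQ]) (by
      intro i
      have h1 : ψ (c ^ n • e i) ∈ (Submodule.span R (Set.range fun j => e (Fin.castLE hnd j))).map ψ := by
        rw [Submodule.map_span, ← Set.range_comp, map_smul, hψe]
        have : (ψ ∘ fun j => e (Fin.castLE hnd j)) = fun j : Fin d => f ^ (j : ℕ) := by
          ext j
          simp [hψe]
        rw [this]
        have h3 : c ^ n = c ^ (n - i) * c ^ (i : ℕ) := by rw [← pow_add]; congr 1; omega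
        rw [h3, mul_smul]
        exact Submodule.smul_mem _ _ (hKN _)
      obtain ⟨z, hz, hzz⟩ := h1
      rwa [← hψ hzz])
  let k := IsLocalRing.ResidueField R
  let ρ : (Fin n → R) →ₗ[R] (Fin n → k) :=
    LinearMap.pi fun i => (Algebra.linearMap R k) ∘ₗ LinearMap.proj i
  have hρ : Function.Surjective ρ := by
    intro y
    choose z hz using fun i => IsLocalRing.residue_surjective (y i)
    exact ⟨z, funext hz⟩
  have hρk : LinearMap.ker φ ≤ LinearMap.ker ρ := by
    intro r hr
    rw [LinearMap.mem_ker] at hr ⊢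
    funext i
    have := hcon (∑ j : Fin n, monomial (j : ℕ) (r j)) (by
      rw [map_sum, ← hr]
      simp [φ, Fintype.linearCombination_apply, aeval_monomial, Algebra.smul_def]) i
    have h2 : (∑ j : Fin n, monomial (j : ℕ) (r j)).coeff (i : ℕ) = r i := by
      simp [coeff_monomial, Fin.val_inj]
    rw [h2] at this
    change IsLocalRing.residue R (r i) = 0
    rw [IsLocalRing.residue_eq_zero_iff]
    exact this
  let σ : M →ₗ[R] (Fin n → k) := (LinearMap.ker φ).liftQ ρ hρk
  let τ : (M ⧸ LinearMap.range (LinearMap.lsmul R M x)) →ₗ[R] (Fin n → k) :=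
    Submodule.liftQ _ σ (by
      rintro _ ⟨y, rfl⟩
      rw [LinearMap.mem_ker]
      change σ (x • y) = 0
      rw [map_smul]
      funext i
      change x • (σ y i) = 0
      rw [Algebra.smul_def]
      have : algebraMap R k x = 0 := (IsLocalRing.residue_eq_zero_iff x).mpr hxm
      rw [this, zero_mul])
  have hτ : Function.Surjective τ := by
    intro y
    obtain ⟨z, rfl⟩ := hρ y
    exact ⟨Submodule.Quotient.mk (Submodule.Quotient.mk z), rfl⟩
  have h1 := (Module.length_le_of_surjective τ hτ).trans key
  have h2 : Module.length R k = 1 := by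
    rw [Module.length_eq_of_surjective (S := R) (R := k) IsLocalRing.residue_surjective]
    exact Module.length_eq_one k k
  rw [Module.length_pi, h2, ← hL] at h1
  have h3 : (n : ℕ∞) ≤ ((d * L : ℕ) : ℕ∞) := by simpa using h1
  have h4 : n ≤ d * L := by exact_mod_cast h3
  simp only [n] at h4
  omega

lemma val_of_unit_coeff {A K : Type*} [CommRing A] [IsLocalRing A] [Field K] [Algebra A K] [IsIntegrallyClosedIn A K]
    (f : K) (n : ℕ) : ∀ p : A[X], p.natDegree ≤ n → aeval f p = 0 → (∃ i, IsUnit (p.coeff i)) →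
     (∃ a : A, algebraMap A K a = f) ∨ (∃ a b : A, IsUnit b ∧ algebraMap A K a * f = algebraMap A K b) := by
  induction n with
  | zero =>
    intro p hp hpf ⟨i, hi⟩
    have hpc := eq_C_of_natDegree_le_zero hp
    have : i = 0 := by
      by_contra h
      rw [coeff_eq_zero_of_natDegree_lt (by omega)] at hi
      simp at hi
    subst this
    rw [hpc, aeval_C] at hpf
    have := hi.map (algebraMap A K)
    rw [hpf] at this
    simp at this
  | succ n ih =>
    intro p hp hpf ⟨i, hi⟩
    by_cases hpn : p.natDegree ≤ n
    · exact ih p hpn hpf ⟨i, hi⟩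
    have hpn : p.natDegree = n + 1 := by omega
    have hint := isIntegral_leadingCoeff_smul p f hpf
    obtain ⟨b, hb⟩ := IsIntegrallyClosedIn.isIntegral_iff.mp hint
    rw [Algebra.smul_def] at hb
    by_cases hl : IsUnit p.leadingCoeff
    · left
      obtain ⟨u, hu⟩ := hl
      refine ⟨↑u⁻¹ * b, ?_⟩
      rw [map_mul, hb, ← hu, ← mul_assoc, ← map_mul]
      simp
    by_cases hbu : IsUnit b
    · right
      exact ⟨_, b, hbu, hb.symm⟩
    refine ih (p.eraseLead + monomial n b) ?_ ?_ ?_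
    · refine (natDegree_add_le _ _).trans (max_le ?_ (natDegree_monomial_le _))
      have := eraseLead_natDegree_le p
      omega
    · have := eraseLead_add_monomial_natDegree_leadingCoeff p
      have h2 : aeval f p.eraseLead + aeval f (monomial p.natDegree p.leadingCoeff) = 0 := by
        rw [← map_add, this, hpf]
      rw [map_add, aeval_monomial, hb, ← h2, aeval_monomial, hpn, pow_succ]
      ring
    · have hin : i ≠ n + 1 := by
        rintro rfl
        rw [← hpn] at hi
        exact hl hi
      refine ⟨i, ?_⟩
      rw [coeff_add, eraseLead_coeff_of_ne _ (by omega), coeff_monomial]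
      split_ifs
      · by_contra hcon
        have h3 := (IsLocalRing.maximalIdeal A).sub_mem hcon hbu
        rw [add_sub_cancel_right] at h3
        exact h3 hi
      · simpa using hi

lemma RPlus_val (R : Type u) [CommRing R] [IsDomain R] [IsNoetherianRing R]
    [IsLocalRing R] [Ring.KrullDimLE 1 R] (x : R) (hx0 : x ≠ 0)
    (hxm : x ∈ IsLocalRing.maximalIdeal R) [IsLocalRing (RPlus R)] (a b : RPlus R) (ha : a ≠ 0) :
    (∃ c, b = a * c) ∨ (∃ c, a = b * c) := by
  let K := AlgebraicClosure (FractionRing R)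
  have hinj : Function.Injective (algebraMap R K) := by
    rw [IsScalarTower.algebraMap_eq R (FractionRing R) K]
    exact (algebraMap (FractionRing R) K).injective.comp (IsFractionRing.injective R _)
  have : FaithfulSMul R K := (faithfulSMul_iff_algebraMap_injective R K).mpr hinj
  have ha' : (a : K) ≠ 0 := by simpa using ha
  let f : K := (b : K) / (a : K)
  have hfa : f * a = b := div_mul_cancel₀ _ ha'
  have hf : IsAlgebraic R f := by
    rw [IsFractionRing.isAlgebraic_iff R (FractionRing R) K]
    exact Algebra.IsAlgebraic.isAlgebraic f
  obtain ⟨p, hp, i, hi⟩ := exists_unit_coeff R x hx0 hxm K f hf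
  have : IsIntegrallyClosedIn (RPlus R) K := inferInstance
  rcases val_of_unit_coeff (A := RPlus R) f _ (p.map (algebraMap R (RPlus R))) le_rfl
    (by rw [aeval_map_algebraMap, hp]) ⟨i, by rw [coeff_map]; exact hi.map _⟩ with
    ⟨c, hc⟩ | ⟨c, d, hd, hcd⟩
  · left
    refine ⟨c, Subtype.ext ?_⟩
    have hc : (c : K) = f := hc
    change (b : K) = a * c
    rw [hc, ← hfa, mul_comm]
  · right
    obtain ⟨u, rfl⟩ := hd
    refine ⟨c * ↑u⁻¹, Subtype.ext ?_⟩
    have hcd : (c : K) * f = ((u : RPlus R) : K) := hcd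
    have hu : ((u : RPlus R) : K) * ((↑u⁻¹ : RPlus R) : K) = 1 := by
      have := congrArg (fun z : RPlus R => (z : K)) u.mul_inv
      exact this
    change (a : K) = b * (c * ((↑u⁻¹ : RPlus R) : K))
    rw [← hfa]
    linear_combination (-(a : K)) * hu - (a : K) * ((↑u⁻¹ : RPlus R) : K) * hcd

/-- Let `(R, m)` be a one-dimensional Noetherian complete local
domain and let `v : R⁺ → ℚ ∪ {∞}` be a valuation, nonnegative on `R⁺` and strictly
positive on `mR⁺`, with `v(a) = ∞` iff `a = 0`. Let `m_{R⁺}` be the unique maximal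
ideal of the quasi-local ring `R⁺`. Then an `R⁺`-module `M` is almost zero with
respect to `v` if and only if `m_{R⁺} · M = 0`. -/
theorem stmt_15 (R : Type u) [CommRing R] [IsDomain R] [IsNoetherianRing R]
    [IsLocalRing R] [IsAdicComplete (IsLocalRing.maximalIdeal R) R]
    (hdim : ringKrullDim R = 1)
    (v : AddValuation (RPlus R) (WithTop ℚ))
    (hnn : ∀ a : RPlus R, 0 ≤ v a)
    (hpos : ∀ a ∈ Ideal.map (algebraMap R (RPlus R)) (IsLocalRing.maximalIdeal R),
      (0 : WithTop ℚ) < v a)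
    (hsupp : ∀ a : RPlus R, v a = ⊤ ↔ a = 0)
    (h : IsLocalRing (RPlus R))
    (M : Type u) [AddCommGroup M] [Module (RPlus R) M] :
    (∀ (m : M) (ε : ℚ), 0 < ε → ∃ a : RPlus R, v a < (ε : WithTop ℚ) ∧ a • m = 0) ↔
    (∀ a ∈ @IsLocalRing.maximalIdeal (RPlus R) _ h, ∀ m : M, a • m = 0) := by
  let K := AlgebraicClosure (FractionRing R)
  have hinj : Function.Injective (algebraMap R K) := by
    rw [IsScalarTower.algebraMap_eq R (FractionRing R) K]
    exact (algebraMap (FractionRing R) K).injective.comp (IsFractionRing.injective R _)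
  have : Ring.KrullDimLE 1 R := by
    rw [Ring.KrullDimLE, Order.krullDimLE_iff]
    exact hdim.le
  have hnf : ¬ IsField R := by
    intro hF
    rw [ringKrullDim_eq_zero_of_isField hF] at hdim
    exact zero_ne_one hdim
  obtain ⟨x, hxm, hx0⟩ := Submodule.exists_mem_ne_zero_of_ne_bot
    (fun hb => hnf (IsLocalRing.isField_iff_maximalIdeal_eq.mpr hb))
  constructor
  · intro H b hb m
    by_cases hb0 : b = 0
    · rw [hb0, zero_smul]
    have hrad : b ∈ (Ideal.map (algebraMap R (RPlus R)) (IsLocalRing.maximalIdeal R)).radical := by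
      rw [Ideal.radical_eq_sInf, Ideal.mem_sInf]
      rintro P ⟨hP, hPp⟩
      have h1 := Ideal.map_le_iff_le_comap.mp hP
      have h2 : (P.comap (algebraMap R (RPlus R))).IsPrime := Ideal.IsPrime.comap _
      have h3 := (IsLocalRing.maximalIdeal.isMaximal R).eq_of_le h2.ne_top h1
      have h4 : (P.comap (algebraMap R (RPlus R))).IsMaximal := h3 ▸ IsLocalRing.maximalIdeal.isMaximal R
      have h5 : P.IsMaximal := Ideal.isMaximal_of_isIntegral_of_isMaximal_comap (R := R) P h4
      rw [IsLocalRing.eq_maximalIdeal h5]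
      exact hb
    obtain ⟨n, hn⟩ := hrad
    have hvb : 0 < v b := by
      refine lt_of_le_of_ne (hnn b) fun h0 => ?_
      have := hpos _ hn
      rw [AddValuation.map_pow, ← h0, smul_zero] at this
      exact lt_irrefl _ this
    obtain ⟨q, hq⟩ := WithTop.ne_top_iff_exists.mp (fun ht => hb0 ((hsupp b).mp ht))
    have hq0 : 0 < q := by
      rw [← hq] at hvb
      exact_mod_cast hvb
    obtain ⟨a, hav, ham⟩ := H m q hq0
    have ha0 : a ≠ 0 := by
      rintro rfl
      rw [(hsupp 0).mpr rfl] at hav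
      exact not_top_lt hav
    rcases RPlus_val R x hx0 hxm a b ha0 with ⟨c, rfl⟩ | ⟨c, rfl⟩
    · rw [mul_comm, mul_smul, ham, smul_zero]
    · exfalso
      have hav : v (b * c) < v b := hq ▸ hav
      rw [AddValuation.map_mul] at hav
      exact not_lt_of_ge (le_add_of_nonneg_right (hnn c)) hav
  · intro H m ε hε
    let X : RPlus R := algebraMap R (RPlus R) x
    have hX : X ∈ Ideal.map (algebraMap R (RPlus R)) (IsLocalRing.maximalIdeal R) :=
      Ideal.mem_map_of_mem _ hxm
    have hvX := hpos _ hX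
    have hX0 : X ≠ 0 := by
      intro h0
      apply hx0
      apply hinj
      rw [map_zero]
      exact congrArg (fun z : RPlus R => (z : K)) h0
    obtain ⟨q, hq⟩ := WithTop.ne_top_iff_exists.mp (fun ht => hX0 ((hsupp X).mp ht))
    have hq0 : 0 < q := by
      rw [← hq] at hvX
      exact_mod_cast hvX
    obtain ⟨n, hn⟩ := exists_nat_gt (q / ε)
    have hn0 : 0 < n := by
      have : (0 : ℚ) < n := (div_pos hq0 hε).trans hn
      exact_mod_cast this
    obtain ⟨y, hy⟩ := IsAlgClosed.exists_pow_nat_eq (X : K) hn0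
    have hyi : IsIntegral R y := IsIntegral.of_pow hn0 (hy ▸ X.2)
    let Y : RPlus R := ⟨y, hyi⟩
    have hY : Y ^ n = X := Subtype.ext hy
    have hvY : n • v Y = v X := by rw [← hY, AddValuation.map_pow]
    have hY0 : Y ≠ 0 := by
      intro h0
      rw [h0, zero_pow hn0.ne'] at hY
      exact hX0 hY.symm
    obtain ⟨r, hr⟩ := WithTop.ne_top_iff_exists.mp (fun ht => hY0 ((hsupp Y).mp ht))
    have hrq : n * r = q := by
      rw [← hr, ← hq] at hvY
      have : ((n • r : ℚ) : WithTop ℚ) = (q : WithTop ℚ) := by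
        rw [← hvY]; exact WithTop.coe_nsmul r n
      rw [← nsmul_eq_mul]
      exact_mod_cast this
    refine ⟨Y, ?_, H Y ?_ m⟩
    · rw [← hr, WithTop.coe_lt_coe]
      rw [div_lt_iff₀ hε, ← hrq] at hn
      have : (0 : ℚ) < n := by exact_mod_cast hn0
      exact lt_of_mul_lt_mul_left hn this.le
    · rw [IsLocalRing.mem_maximalIdeal, mem_nonunits_iff]
      intro hu
      have hXu : IsUnit X := hY ▸ hu.pow n
      obtain ⟨z, hz⟩ := hXu.exists_right_inv
      have h1 : v X + v z = 0 := by rw [← AddValuation.map_mul, hz, AddValuation.map_one]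
      have h2 : v X ≤ 0 := h1 ▸ le_add_of_nonneg_right (hnn z)
      exact not_lt_of_ge h2 hvX
end

section
/- Let (R_n, m_n), n ∈ ℕ, be a chain of Noetherian local rings with R_n ⊆ R_{n+1} and m_{n+1} ∩ R_n = m_n for all n, such that R_m is flat as an R_n-module whenever n ≤ m. Let A = ⋃_{n ∈ ℕ} R_n. Then gldim(A) ≤ sup{gldim(R_n) : n ∈ ℕ} + 1. -/
set_option synthInstance.maxHeartbeats 400000
set_option maxHeartbeats 1000000

universe u

open CategoryTheory CategoryTheory.Limits

/-- `hasPdLE A n M` : the `A`-module `M` admits a projective resolution of length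
at most `n`, i.e. has projective dimension `≤ n`. -/
def hasPdLE (A : Type u) [CommRing A] : ℕ → ModuleCat.{u} A → Prop
  | 0, M => Projective M
  | n + 1, M => ∃ (P : ModuleCat.{u} A) (f : P ⟶ M), Epi f ∧ Projective P ∧
      hasPdLE A n (kernel f)

/-- The projective dimension `pd_A(M)` of an `A`-module `M`, valued in `ℕ∞`
(`⊤` if no finite projective resolution exists). -/
noncomputable def projDim (A : Type u) [CommRing A] (M : Type u) [AddCommGroup M]
    [Module A M] : ℕ∞ :=
  sInf {n : ℕ∞ | ∃ k : ℕ, n = k ∧ hasPdLE A k (ModuleCat.of A M)}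

/-- The global dimension of a commutative ring: the supremum of the projective
dimensions of all its modules. -/
noncomputable def gldim (A : Type u) [CommRing A] : ℕ∞ :=
  ⨆ M : ModuleCat.{u} A, projDim A M

/-- Reinterpret an `ℕ∞`-valued homological dimension as an element of
`WithBot (WithTop ℕ)`, to compare it with Krull dimensions. -/
def toWB (n : ℕ∞) : WithBot (WithTop ℕ) := ((show WithTop ℕ from n) : WithBot (WithTop ℕ))

section Helpers

theorem hasPdLE_iff (A : Type u) [CommRing A] (n : ℕ) (M : ModuleCat.{u} A) :
    hasPdLE A n M ↔ HasProjectiveDimensionLE M n := by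
  induction n generalizing M with
  | zero =>
    change Projective M ↔ _
    rw [projective_iff_hasProjectiveDimensionLE_zero]
  | succ n ih =>
    have key : ∀ (P : ModuleCat.{u} A) (f : P ⟶ M), Epi f →
        (ShortComplex.mk (kernel.ι f) f (kernel.condition f)).ShortExact := by
      intro P f hf
      exact { exact := ShortComplex.exact_kernel f
              mono_f := by dsimp; infer_instance
              epi_g := hf }
    constructor
    · rintro ⟨P, f, hf, hP, hk⟩
      exact ((key P f hf).hasProjectiveDimensionLT_X₃_iff n hP).mpr ((ih _).mp hk)
    · intro h
      refine ⟨Projective.over M, Projective.π M, inferInstance, inferInstance, (ih _).mpr ?_⟩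
      exact ((key _ (Projective.π M) inferInstance).hasProjectiveDimensionLT_X₃_iff n
        (by dsimp; infer_instance)).mp h

/-- Projective dimension at most `n`, for unbundled modules. -/
abbrev PD (A : Type u) [CommRing A] (n : ℕ) (M : Type u) [AddCommGroup M] [Module A M] : Prop :=
  HasProjectiveDimensionLE (ModuleCat.of A M) n

theorem PD_zero (A : Type u) [CommRing A] (M : Type u) [AddCommGroup M] [Module A M] :
    PD A 0 M ↔ Module.Projective A M := by
  rw [PD, ← projective_iff_hasProjectiveDimensionLE_zero, ← IsProjective.iff_projective]

section
variable {A : Type u} [CommRing A] {K P M : Type u} [AddCommGroup K] [Module A K]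
  [AddCommGroup P] [Module A P] [AddCommGroup M] [Module A M]
  (f : K →ₗ[A] P) (g : P →ₗ[A] M)

theorem ses (hf : Function.Injective f) (hfg : Function.Exact f g) (hg : Function.Surjective g) :
    (ShortComplex.mk (ModuleCat.ofHom f) (ModuleCat.ofHom g)
      (by rw [← ModuleCat.ofHom_comp, hfg.linearMap_comp_eq_zero]; rfl)).ShortExact :=
  ModuleCat.shortComplex_shortExact _ hfg hf hg

theorem PD_succ_iff [Module.Projective A P] (hf : Function.Injective f)
    (hfg : Function.Exact f g) (hg : Function.Surjective g) (n : ℕ) :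
    PD A (n + 1) M ↔ PD A n K :=
  (ses f g hf hfg hg).hasProjectiveDimensionLT_X₃_iff n
    ((IsProjective.iff_projective (R := A) P).mp inferInstance)

theorem PD_of_ses (hf : Function.Injective f)
    (hfg : Function.Exact f g) (hg : Function.Surjective g) (n : ℕ)
    (hK : PD A n K) (hP : PD A n P) : PD A (n + 1) M :=
  (ses f g hf hfg hg).hasProjectiveDimensionLT_X₃ (n + 1) hK
    (hasProjectiveDimensionLT_of_ge (ModuleCat.of A P) (n + 1) (n + 1 + 1) (by omega))

theorem PD_ker_iff [Module.Projective A P] (hg : Function.Surjective g) (n : ℕ) :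
    PD A (n + 1) M ↔ PD A n (LinearMap.ker g) :=
  PD_succ_iff (LinearMap.ker g).subtype g Subtype.val_injective
    (LinearMap.exact_subtype_ker_map g) hg n

end

theorem exists_cover (R : Type u) [CommRing R] (M : Type u) [AddCommGroup M] [Module R M] :
    ∃ (P : Type u) (_ : AddCommGroup P) (_ : Module R P) (_ : Module.Projective R P)
      (g : P →ₗ[R] M), Function.Surjective g :=
  ⟨M →₀ R, inferInstance, inferInstance, inferInstance,
    Finsupp.linearCombination R (id : M → M), Finsupp.linearCombination_id_surjective R M⟩

open TensorProduct in
theorem PD_baseChange (R A : Type u) [CommRing R] [CommRing A] [Algebra R A] [Module.Flat R A]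
    (n : ℕ) (M : Type u) [AddCommGroup M] [Module R M] (h : PD R n M) :
    PD A n (A ⊗[R] M) := by
  induction n generalizing M with
  | zero =>
    rw [PD_zero] at h ⊢
    infer_instance
  | succ n ih =>
    obtain ⟨P, _, _, _, g, hg⟩ := exists_cover R M
    have hex : Function.Exact g.ker.subtype g := LinearMap.exact_subtype_ker_map g
    have h1 := (PD_ker_iff g hg n).mp h
    refine (PD_succ_iff (g.ker.subtype.baseChange A) (g.baseChange A) ?_ ?_ ?_ n).mpr (ih _ h1)
    · exact Module.Flat.lTensor_preserves_injective_linearMap (M := A) g.ker.subtype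
        Subtype.val_injective
    · exact lTensor_exact A hex hg
    · exact LinearMap.lTensor_surjective A hg

open DirectSum in
theorem PD_directSum (A : Type u) [CommRing A] (n : ℕ) (M : ℕ → Type u)
    [∀ i, AddCommGroup (M i)] [∀ i, Module A (M i)] (h : ∀ i, PD A n (M i)) :
    PD A n (⨁ i, M i) := by
  induction n generalizing M with
  | zero =>
    rw [PD_zero, Module.Projective.directSum_iff]
    intro i
    exact (PD_zero A (M i)).mp (h i)
  | succ n ih =>
    choose P i1 i2 i3 g hg using fun i => exists_cover A (M i)
    have hex : ∀ i, Function.Exact (g i).ker.subtype (g i) :=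
      fun i => LinearMap.exact_subtype_ker_map (g i)
    have h1 := fun i => (PD_ker_iff (g i) (hg i) n).mp (h i)
    refine (PD_succ_iff (DirectSum.lmap fun i => (g i).ker.subtype)
      (DirectSum.lmap g) ?_ ?_ ?_ n).mpr (ih _ h1)
    · exact (DirectSum.lmap_injective _).mpr fun i => Subtype.val_injective
    · rw [LinearMap.exact_iff, DirectSum.ker_lmap, DirectSum.range_lmap]
      simp
    · exact (DirectSum.lmap_surjective _).mpr hg

section Chain
open TensorProduct DirectSum

variable {A : Type u} [CommRing A] (Rn : ℕ → Subring A)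
    (hmono : ∀ {n m : ℕ}, n ≤ m → Rn n ≤ Rn m)

theorem flat_of_directed (R B : Type u) [CommRing R] [CommRing B] [Algebra R B]
    (H : ∀ (l : ℕ) (x : Fin l → B), ∃ (C : Type u) (_ : CommRing C) (_ : Algebra R C)
      (_ : Module.Flat R C) (φ : C →ₗ[R] B) (_ : Function.Injective φ) (y : Fin l → C),
      ∀ i, φ (y i) = x i) : Module.Flat R B := by
  refine Module.Flat.of_forall_isTrivialRelation ?_
  intro l f x hfx
  obtain ⟨C, _, _, _, φ, hφ, y, hy⟩ := H l x
  have key := Module.Flat.isTrivialRelation_of_sum_smul_eq_zero (R := R) (M := C) (f := f) (x := y)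
  obtain ⟨k, a, z, h1, h2⟩ := key (by
    apply hφ
    simpa [hy] using hfx)
  refine ⟨k, a, fun j => φ (z j), fun i => ?_, h2⟩
  rw [← hy, h1 i]
  simp

theorem chain_flat (hmono : ∀ {n m : ℕ}, n ≤ m → Rn n ≤ Rn m)
    (hunion : ∀ a : A, ∃ n, a ∈ Rn n)
    (hflat : ∀ n m (h : n ≤ m), @Module.Flat (Rn n) (Rn m) _ _
      (@Algebra.toModule _ _ _ _ ((Subring.inclusion (hmono h)).toAlgebra))) (n : ℕ) :
    Module.Flat (Rn n) A := by
  apply flat_of_directed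
  intro l x
  choose N hN using fun i => hunion (x i)
  obtain ⟨m, hm, hx⟩ : ∃ m, n ≤ m ∧ ∀ i, x i ∈ Rn m := by
    refine ⟨max n (Finset.univ.sup N), le_max_left _ _, fun i => ?_⟩
    exact hmono (le_trans (Finset.le_sup (Finset.mem_univ i)) (le_max_right _ _)) (hN i)
  let alg : Algebra (Rn n) (Rn m) := (Subring.inclusion (hmono hm)).toAlgebra
  refine ⟨Rn m, inferInstance, alg, hflat n m hm,
    { toFun := Subtype.val, map_add' := fun _ _ => rfl, map_smul' := fun _ _ => rfl },
    Subtype.val_injective, fun i => ⟨x i, hx i⟩, fun i => rfl⟩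

variable (M : Type u) [AddCommGroup M] [Module A M]

/-- Base change of `M` to `A` along the inclusion of `Rn n`. -/
def NN (n : ℕ) : Type u := A ⊗[Rn n] M

noncomputable instance (n : ℕ) : AddCommGroup (NN Rn M n) :=
  inferInstanceAs (AddCommGroup (A ⊗[Rn n] M))

noncomputable instance (n : ℕ) : Module A (NN Rn M n) :=
  inferInstanceAs (Module A (A ⊗[Rn n] M))

/-- Pure tensors. -/
noncomputable def nn (n : ℕ) (a : A) (m : M) : NN Rn M n := (a ⊗ₜ[Rn n] m : A ⊗[Rn n] M)

theorem nn_add (n : ℕ) (a : A) (m m' : M) : nn Rn M n a (m + m') = nn Rn M n a m + nn Rn M n a m' :=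
  TensorProduct.tmul_add a m m'

theorem nn_zero (n : ℕ) (a : A) : nn Rn M n a 0 = 0 :=
  TensorProduct.tmul_zero M a

theorem nn_smul (n : ℕ) (a : A) (ha : a ∈ Rn n) (m : M) :
    nn Rn M n 1 (a • m) = nn Rn M n a m := by
  have e : (1 : A) ⊗ₜ[Rn n] (a • m) = a ⊗ₜ m := by
    have : a • m = (⟨a, ha⟩ : Rn n) • m := rfl
    rw [this, ← smul_tmul]
    congr 1
    exact mul_one a
  exact e

theorem nn_induction (n : ℕ) {p : NN Rn M n → Prop} (x : NN Rn M n) (zero : p 0)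
    (tmul : ∀ a m, p (nn Rn M n a m)) (add : ∀ x y, p x → p y → p (x + y)) : p x :=
  TensorProduct.induction_on (motive := p) x zero tmul add

/-- Linear maps out of `NN`. -/
noncomputable def nnLift (n : ℕ) {Q : Type u} [AddCommGroup Q] [Module A Q] (f : M →+ Q)
    (hf : ∀ (a : A), a ∈ Rn n → ∀ m, f (a • m) = a • f m) : NN Rn M n →ₗ[A] Q :=
  (LinearMap.liftBaseChange A
    ({ f with map_smul' := fun r m => hf r r.2 m } : M →ₗ[Rn n] Q) : A ⊗[Rn n] M →ₗ[A] Q)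

theorem nnLift_nn (n : ℕ) {Q : Type u} [AddCommGroup Q] [Module A Q] (f : M →+ Q)
    (hf : ∀ (a : A), a ∈ Rn n → ∀ m, f (a • m) = a • f m) (a : A) (m : M) :
    nnLift Rn M n f hf (nn Rn M n a m) = a • f m := rfl

theorem smul_nn (n : ℕ) (a b : A) (m : M) : a • nn Rn M n b m = nn Rn M n (a * b) m := rfl

/-- Transition maps. -/
noncomputable def tr (n : ℕ) (h : Rn n ≤ Rn (n + 1)) : NN Rn M n →ₗ[A] NN Rn M (n + 1) :=
  nnLift Rn M n
    { toFun := fun m => nn Rn M (n + 1) 1 m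
      map_add' := fun x y => nn_add _ _ _ _ _ _
      map_zero' := nn_zero _ _ _ _ }
    (fun a ha m => by
      change nn Rn M (n + 1) 1 (a • m) = a • nn Rn M (n + 1) 1 m
      rw [nn_smul Rn M _ _ (h ha), smul_nn, mul_one])

theorem tr_tmul (n : ℕ) (h : Rn n ≤ Rn (n + 1)) (a : A) (m : M) :
    tr Rn M n h (nn Rn M n a m) = nn Rn M (n + 1) a m := by
  rw [tr, nnLift_nn]
  change a • nn Rn M (n + 1) 1 m = _
  rw [smul_nn, mul_one]

/-- The augmentation. -/
noncomputable def aug : (⨁ n, NN Rn M n) →ₗ[A] M :=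
  DirectSum.toModule A ℕ M fun n => nnLift Rn M n (AddMonoidHom.id M) (fun _ _ _ => rfl)

theorem aug_lof (n : ℕ) (a : A) (m : M) :
    aug Rn M (DirectSum.lof A ℕ (NN Rn M) n (nn Rn M _ a m)) = a • m := by
  rw [aug, DirectSum.toModule_lof, nnLift_nn]
  rfl

/-- The shift map. -/
noncomputable def shift (h : ∀ n, Rn n ≤ Rn (n + 1)) :
    (⨁ n, NN Rn M n) →ₗ[A] (⨁ n, NN Rn M n) :=
  DirectSum.toModule A ℕ _ fun n => DirectSum.lof A ℕ (NN Rn M) (n + 1) ∘ₗ tr Rn M n (h n)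

theorem shift_lof (h : ∀ n, Rn n ≤ Rn (n + 1)) (n : ℕ) (x : NN Rn M n) :
    shift Rn M h (DirectSum.lof A ℕ (NN Rn M) n x) =
      DirectSum.lof A ℕ (NN Rn M) (n + 1) (tr Rn M n (h n) x) := by
  simp [shift]

theorem shift_zero (h : ∀ n, Rn n ≤ Rn (n + 1)) (y : ⨁ n, NN Rn M n) :
    shift Rn M h y 0 = 0 := by
  have : DirectSum.component A ℕ (NN Rn M) 0 ∘ₗ shift Rn M h = 0 := by
    refine DirectSum.linearMap_ext A fun n => LinearMap.ext fun x => ?_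
    simp only [LinearMap.comp_apply, shift_lof]
    rw [DirectSum.component.of, dif_neg (by omega)]; rfl
  exact LinearMap.congr_fun this y

theorem shift_succ (h : ∀ n, Rn n ≤ Rn (n + 1)) (y : ⨁ n, NN Rn M n) (k : ℕ) :
    shift Rn M h y (k + 1) = tr Rn M k (h k) (y k) := by
  have : DirectSum.component A ℕ (NN Rn M) (k + 1) ∘ₗ shift Rn M h =
      tr Rn M k (h k) ∘ₗ DirectSum.component A ℕ (NN Rn M) k := by
    refine DirectSum.linearMap_ext A fun n => LinearMap.ext fun x => ?_
    simp only [LinearMap.comp_apply, shift_lof]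
    rw [DirectSum.component.of, DirectSum.component.of]
    by_cases hnk : n = k
    · subst hnk; simp
    · rw [dif_neg hnk, dif_neg (by omega), map_zero]
  exact LinearMap.congr_fun this y

/-- The telescope map. -/
noncomputable def tel (h : ∀ n, Rn n ≤ Rn (n + 1)) :
    (⨁ n, NN Rn M n) →ₗ[A] (⨁ n, NN Rn M n) :=
  (LinearMap.id : (⨁ n, NN Rn M n) →ₗ[A] (⨁ n, NN Rn M n)) - shift Rn M h

theorem tel_inj (h : ∀ n, Rn n ≤ Rn (n + 1)) : Function.Injective (tel Rn M h) := by
  rw [← LinearMap.ker_eq_bot, LinearMap.ker_eq_bot']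
  intro y hy
  have hy' : y = shift Rn M h y := sub_eq_zero.mp hy
  have : ∀ n, y n = 0 := by
    intro n
    induction n with
    | zero => rw [hy', shift_zero]
    | succ n ih => rw [hy', shift_succ, ih, map_zero]
  exact DFinsupp.ext this

theorem aug_surj : Function.Surjective (aug Rn M) := fun m =>
  ⟨DirectSum.lof A ℕ (NN Rn M) 0 (nn Rn M _ 1 m), by rw [aug_lof, one_smul]⟩

theorem aug_tel (h : ∀ n, Rn n ≤ Rn (n + 1)) : aug Rn M ∘ₗ tel Rn M h = 0 := by
  refine DirectSum.linearMap_ext A fun n => LinearMap.ext fun x => ?_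
  simp only [LinearMap.comp_apply, tel, LinearMap.sub_apply, LinearMap.id_apply, shift_lof,
    map_sub, LinearMap.zero_apply]
  induction x using nn_induction Rn M n with
  | zero => simp
  | tmul a m => rw [tr_tmul, aug_lof, aug_lof, sub_self]
  | add x y hx hy =>
    rw [sub_eq_zero] at *
    simp only [map_add, hx, hy]

theorem tel_class (h : ∀ n, Rn n ≤ Rn (n + 1)) (hmono : Monotone Rn)
    (hunion : ∀ a : A, ∃ n, a ∈ Rn n) (y : ⨁ n, NN Rn M n) :
    ∃ k₀, ∀ k, k₀ ≤ k → y - DirectSum.lof A ℕ (NN Rn M) k (nn Rn M _ 1 (aug Rn M y)) ∈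
      LinearMap.range (tel Rn M h) := by
  have hadd : ∀ y z : ⨁ n, NN Rn M n,
      (∃ k₀, ∀ k, k₀ ≤ k → y - DirectSum.lof A ℕ (NN Rn M) k (nn Rn M _ 1 (aug Rn M y)) ∈
        LinearMap.range (tel Rn M h)) →
      (∃ k₀, ∀ k, k₀ ≤ k → z - DirectSum.lof A ℕ (NN Rn M) k (nn Rn M _ 1 (aug Rn M z)) ∈
        LinearMap.range (tel Rn M h)) →
      (∃ k₀, ∀ k, k₀ ≤ k → (y + z) - DirectSum.lof A ℕ (NN Rn M) k (nn Rn M _ 1 (aug Rn M (y + z))) ∈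
        LinearMap.range (tel Rn M h)) := by
    rintro y z ⟨k₁, h₁⟩ ⟨k₂, h₂⟩
    refine ⟨max k₁ k₂, fun k hk => ?_⟩
    rw [map_add, nn_add, map_add, add_sub_add_comm]
    exact Submodule.add_mem _ (h₁ k (le_trans (le_max_left _ _) hk))
      (h₂ k (le_trans (le_max_right _ _) hk))
  have hzero : (∃ k₀, ∀ k, k₀ ≤ k →
      (0 : ⨁ n, NN Rn M n) - DirectSum.lof A ℕ (NN Rn M) k (nn Rn M _ 1 (aug Rn M 0)) ∈
        LinearMap.range (tel Rn M h)) := ⟨0, fun k _ => by simp [nn_zero]⟩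
  induction y using DirectSum.induction_on with
  | zero => exact hzero
  | add y z hy hz => exact hadd y z hy hz
  | of n x =>
    rw [← DirectSum.lof_eq_of A]
    induction x using nn_induction Rn M n with
    | zero => rw [map_zero]; exact hzero
    | add x y hx hy => rw [map_add]; exact hadd _ _ hx hy
    | tmul a m =>
      obtain ⟨N, hN⟩ := hunion a
      refine ⟨max n N, fun k hk => ?_⟩
      have ha : a ∈ Rn k := hmono (le_trans (le_max_right _ _) hk) hN
      have hnk : n ≤ k := le_trans (le_max_left _ _) hk
      rw [aug_lof, nn_smul Rn M _ _ ha]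
      clear ha hk
      induction k, hnk using Nat.le_induction with
      | base => rw [sub_self]; exact Submodule.zero_mem _
      | succ k hk ih =>
        have h2 : DirectSum.lof A ℕ (NN Rn M) k (nn Rn M _ a m) -
            DirectSum.lof A ℕ (NN Rn M) (k + 1) (nn Rn M _ a m) ∈ LinearMap.range (tel Rn M h) :=
          ⟨DirectSum.lof A ℕ (NN Rn M) k (nn Rn M _ a m), by
            simp only [tel, LinearMap.sub_apply, LinearMap.id_apply, shift_lof, tr_tmul]⟩
        have := Submodule.add_mem _ ih h2
        rwa [sub_add_sub_cancel] at this

theorem tel_exact (h : ∀ n, Rn n ≤ Rn (n + 1)) (hmono : Monotone Rn)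
    (hunion : ∀ a : A, ∃ n, a ∈ Rn n) : Function.Exact (tel Rn M h) (aug Rn M) := by
  intro y
  constructor
  · intro hy
    obtain ⟨k, hk⟩ := tel_class Rn M h hmono hunion y
    have := hk k le_rfl
    rw [hy, nn_zero, map_zero, sub_zero] at this
    exact this
  · rintro ⟨z, rfl⟩
    exact LinearMap.congr_fun (aug_tel Rn M h) z

end Chain

theorem PD_of_gldim (R : Type u) [CommRing R] (d : ℕ) (h : gldim R ≤ d) (M : Type u)
    [AddCommGroup M] [Module R M] : PD R d M := by
  have h1 : projDim R M ≤ d := (le_iSup (fun M : ModuleCat.{u} R => projDim R M)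
    (ModuleCat.of R M)).trans h
  have hne : {n : ℕ∞ | ∃ k : ℕ, n = k ∧ hasPdLE R k (ModuleCat.of R M)}.Nonempty := by
    by_contra hc
    rw [Set.not_nonempty_iff_eq_empty] at hc
    rw [projDim, hc, sInf_empty] at h1
    simp at h1
  obtain ⟨k, hk, hk'⟩ := csInf_mem hne
  have h2 : (k : ℕ∞) ≤ d := by rw [← hk]; exact h1
  have := (hasPdLE_iff R k _).mp hk'
  exact hasProjectiveDimensionLT_of_ge _ (k + 1) (d + 1) (by
    have : k ≤ d := by exact_mod_cast h2
    omega)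

end Helpers

/-- Let `(R_n, m_n)`, `n ∈ ℕ`, be a chain of Noetherian local rings
with `R_n ⊆ R_{n+1}`, `m_{n+1} ∩ R_n = m_n`, such that `R_m` is flat over `R_n`
whenever `n ≤ m`, and let `A = ⋃_n R_n`. Then
`gldim A ≤ sup{gldim R_n : n ∈ ℕ} + 1`. -/
theorem stmt_18 (A : Type u) [CommRing A] (Rn : ℕ → Subring A)
    (hmono : ∀ {n m : ℕ}, n ≤ m → Rn n ≤ Rn m)
    (hunion : ∀ a : A, ∃ n, a ∈ Rn n)
    (hnoeth : ∀ n, IsNoetherianRing (Rn n))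
    (hloc : ∀ n, IsLocalRing (Rn n))
    (hmax : ∀ n, Ideal.comap (Subring.inclusion (hmono (Nat.le_succ n)))
        (@IsLocalRing.maximalIdeal _ _ (hloc (n + 1)))
      = @IsLocalRing.maximalIdeal _ _ (hloc n))
    (hflat : ∀ n m (h : n ≤ m), @Module.Flat (Rn n) (Rn m) _ _
      (@Algebra.toModule _ _ _ _ ((Subring.inclusion (hmono h)).toAlgebra))) :
    gldim A ≤ (⨆ n, gldim (Rn n)) + 1 := by
  cases hd : (⨆ n, gldim (Rn n)) with
  | top => simp
  | coe d =>
    refine iSup_le fun M => ?_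
    have hsucc : ∀ n, Rn n ≤ Rn (n + 1) := fun n => hmono (Nat.le_succ n)
    have h1 : ∀ n, PD A d (NN Rn M n) := fun n => by
      have := chain_flat Rn hmono hunion hflat n
      exact PD_baseChange (Rn n) A d M (PD_of_gldim (Rn n) d (hd ▸ le_iSup (fun n => gldim (Rn n)) n) M)
    have h2 := PD_directSum A d _ h1
    have h3 := PD_of_ses _ _ (tel_inj Rn M hsucc)
      (tel_exact Rn M hsucc (fun _ _ h => hmono h) hunion) (aug_surj Rn M) d h2 h2
    exact sInf_le ⟨d + 1, by push_cast; rfl, (hasPdLE_iff A (d + 1) _).mpr h3⟩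
end
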